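/- Let Ω ⊆ C^n be open, π : Ω × C^k → Ω the natural projection, and X a Nash subset of Ω × C^k such that π|_X : X → Ω is proper. Then π(X) is a Nash subset of Ω and dim(X) = dim(π(X)). -/

import Mathlib

open Filter Topology

/-- `X` is an analytic subset of `Ω`: near every point of `Ω` it is the common zero set
of finitely many holomorphic functions. -/
def IsAnalyticIn {E : Type} [NormedAddCommGroup E] [NormedSpace ℂ E] (Ω X : Set E) : Prop :=
  X ⊆ Ω ∧ ∀ z ∈ Ω, ∃ U : Set E, IsOpen U ∧ z ∈ U ∧ ∃ (N : ℕ) (g : Fin N → E → ℂ),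
    (∀ i, DifferentiableOn ℂ (g i) U) ∧ X ∩ U = {x ∈ U | ∀ i, g i x = 0}

/-- `x` is a regular point of `X` of (complex) dimension `d`: near `x`, after a
`ℂ`-linear change of coordinates, `X` is the graph of a holomorphic map defined on an
open subset of `ℂ^d`. -/
def IsRegPtOfDim {E : Type} [NormedAddCommGroup E] [NormedSpace ℂ E]
    (d : ℕ) (X : Set E) (x : E) : Prop :=
  ∃ U : Set E, IsOpen U ∧ x ∈ U ∧
    ∃ (e : ℕ) (L : E ≃L[ℂ] ((Fin d → ℂ) × (Fin e → ℂ)))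
      (Ω : Set (Fin d → ℂ)) (g : (Fin d → ℂ) → (Fin e → ℂ)),
      IsOpen Ω ∧ DifferentiableOn ℂ g Ω ∧
      L '' (X ∩ U) = {p : (Fin d → ℂ) × (Fin e → ℂ) | p.1 ∈ Ω ∧ p.2 = g p.1}

/-- `X` has pure dimension `d`: regular points (necessarily of dimension `d`) are dense in `X`. -/
def PureDim {E : Type} [NormedAddCommGroup E] [NormedSpace ℂ E] (X : Set E) (d : ℕ) : Prop :=
  (∀ x ∈ X, x ∈ closure {y | y ∈ X ∧ IsRegPtOfDim d X y}) ∧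
  (∀ e : ℕ, ∀ x ∈ X, IsRegPtOfDim e X x → e = d)

/-- `d` is the dimension of `X`: the maximum of the dimensions at regular points. -/
def SetDimIs {E : Type} [NormedAddCommGroup E] [NormedSpace ℂ E] (X : Set E) (d : ℕ) : Prop :=
  (∃ x ∈ X, IsRegPtOfDim d X x) ∧ ∀ e : ℕ, ∀ x ∈ X, IsRegPtOfDim e X x → e ≤ d

/-- The natural projection restricted to `Y` is proper over `U`. -/
def ProperProjOn {A B : Type} [TopologicalSpace A] [TopologicalSpace B]
    (U : Set A) (Y : Set (A × B)) : Prop :=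
  ∀ K ⊆ U, IsCompact K → IsCompact {p | p ∈ Y ∧ p.1 ∈ K}

/-- The projection `π|_Y` is regular (an analytic isomorphism) at `p`:
near `p`, `Y` is the graph of a holomorphic map. -/
def ProjRegularAt {A B : Type} [NormedAddCommGroup A] [NormedSpace ℂ A]
    [NormedAddCommGroup B] [NormedSpace ℂ B] (Y : Set (A × B)) (p : A × B) : Prop :=
  ∃ W : Set A, IsOpen W ∧ p.1 ∈ W ∧ ∃ g : A → B, DifferentiableOn ℂ g W ∧
    ∃ V : Set (A × B), IsOpen V ∧ p ∈ V ∧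
      Y ∩ V = {q : A × B | q.1 ∈ W ∧ q.2 = g q.1} ∩ V

/-- The set `S(Y, π)` of singular points of the projection `π|_Y`. -/
def SingProj {A B : Type} [NormedAddCommGroup A] [NormedSpace ℂ A]
    [NormedAddCommGroup B] [NormedSpace ℂ B] (Y : Set (A × B)) : Set (A × B) :=
  {p | p ∈ Y ∧ ¬ ProjRegularAt Y p}

/-- `X` is irreducible as an analytic subset of `Ω`. -/
def IrredAnalyticIn {E : Type} [NormedAddCommGroup E] [NormedSpace ℂ E] (Ω X : Set E) : Prop :=
  IsAnalyticIn Ω X ∧ X.Nonempty ∧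
    ∀ X₁ X₂ : Set E, IsAnalyticIn Ω X₁ → IsAnalyticIn Ω X₂ → X = X₁ ∪ X₂ → X = X₁ ∨ X = X₂

/-- `C` is an irreducible analytic component of `X` (inside `Ω`). -/
def IsIrredComp {E : Type} [NormedAddCommGroup E] [NormedSpace ℂ E] (Ω X C : Set E) : Prop :=
  IrredAnalyticIn Ω C ∧ C ⊆ X ∧
    ∀ C' : Set E, IrredAnalyticIn Ω C' → C ⊆ C' → C' ⊆ X → C' = C

/-- `Z` has generic fiber cardinality `s` over `E`: outside a proper analytic subset of `E`
every fiber of the projection has exactly `s` points. -/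
def GenFiberCard {A B : Type} [NormedAddCommGroup A] [NormedSpace ℂ A]
    (E : Set A) (Z : Set (A × B)) (s : ℕ) : Prop :=
  ∃ T : Set A, IsAnalyticIn E T ∧ T ≠ E ∧ ∀ x ∈ E \ T, Set.ncard {v : B | (x, v) ∈ Z} = s

/-- An algebraic subset of `ℂ^N`. -/
def IsAlgSet (N : ℕ) (V : Set (Fin N → ℂ)) : Prop :=
  ∃ (q : ℕ) (ps : Fin q → MvPolynomial (Fin N) ℂ),
    V = {y | ∀ i, MvPolynomial.eval y (ps i) = 0}

/-- A Nash function on an open set `U ⊆ ℂ^N`. -/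
def NashFn (N : ℕ) (U : Set (Fin N → ℂ)) (f : (Fin N → ℂ) → ℂ) : Prop :=
  DifferentiableOn ℂ f U ∧ ∀ x₀ ∈ U, ∃ V : Set (Fin N → ℂ), IsOpen V ∧ x₀ ∈ V ∧
    ∃ P : Polynomial (MvPolynomial (Fin N) ℂ), P ≠ 0 ∧
      ∀ x ∈ V ∩ U, Polynomial.eval₂ (MvPolynomial.eval x) (f x) P = 0

/-- `X` is a Nash subset of `Ω ⊆ ℂ^N`. -/
def IsNashIn (N : ℕ) (Ω X : Set (Fin N → ℂ)) : Prop :=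
  X ⊆ Ω ∧ ∀ z ∈ Ω, ∃ U : Set (Fin N → ℂ), IsOpen U ∧ z ∈ U ∧
    ∃ (q : ℕ) (g : Fin q → (Fin N → ℂ) → ℂ),
      (∀ i, NashFn N U (g i)) ∧ X ∩ U = {x ∈ U | ∀ i, g i x = 0}

section SeveralVariables

open Metric Set

variable {V E : Type*} [NormedAddCommGroup V] [NormedSpace ℂ V] [NormedAddCommGroup E]
  [NormedSpace ℂ E]

/-- The derivative of a holomorphic function of several variables is continuous. -/
theorem continuousOn_fderiv_of_differentiableOn [FiniteDimensional ℂ V] {f : V → ℂ} {O : Set V}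
    (hO : IsOpen O) (hf : DifferentiableOn ℂ f O) : ContinuousOn (fderiv ℂ f) O := by
  have : ProperSpace V := FiniteDimensional.proper ℂ V
  intro p₀ hp₀
  apply ContinuousAt.continuousWithinAt
  obtain ⟨R, hR, hRO⟩ := Metric.nhds_basis_closedBall.mem_iff.1 (hO.mem_nhds hp₀)
  obtain ⟨r, hr, rfl⟩ : ∃ r, 0 < r ∧ R = 2 * r := ⟨R / 2, by positivity, by ring⟩
  have huc := (isCompact_closedBall p₀ (2 * r)).uniformContinuousOn_of_continuous
    (hf.continuousOn.mono hRO)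
  rw [Metric.uniformContinuousOn_iff] at huc
  rw [Metric.continuousAt_iff]
  intro ε hε
  obtain ⟨δ, hδ, H⟩ := huc (ε * r / 4) (by positivity)
  refine ⟨min δ r, by positivity, fun p hp => ?_⟩
  have hpδ : dist p p₀ < δ := lt_of_lt_of_le hp (min_le_left _ _)
  have hpr : dist p p₀ < r := lt_of_lt_of_le hp (min_le_right _ _)
  have hmem : ∀ v ∈ ball p₀ r, v + (p - p₀) ∈ closedBall p₀ (2 * r) := by
    intro v hv
    rw [mem_closedBall, dist_eq_norm]
    rw [mem_ball, dist_eq_norm] at hv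
    rw [dist_eq_norm] at hpr
    calc ‖v + (p - p₀) - p₀‖ = ‖(v - p₀) + (p - p₀)‖ := by congr 1; abel
      _ ≤ ‖v - p₀‖ + ‖p - p₀‖ := norm_add_le _ _
      _ ≤ 2 * r := by linarith
  have hmem' : ∀ v ∈ ball p₀ r, v ∈ closedBall p₀ (2 * r) := fun v hv => by
    rw [mem_closedBall]; rw [mem_ball] at hv; linarith
  have hnear : ∀ v ∈ ball p₀ r, dist (f (v + (p - p₀))) (f v) < ε * r / 4 := fun v hv =>
    H _ (hmem v hv) _ (hmem' v hv) (by rwa [dist_eq_norm, add_sub_cancel_left, ← dist_eq_norm])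
  have hd1 : DifferentiableOn ℂ (fun v => f (v + (p - p₀))) (ball p₀ r) :=
    hf.comp (by fun_prop) fun v hv => hRO (hmem v hv)
  have hd2 : DifferentiableOn ℂ f (ball p₀ r) := hf.mono fun v hv => hRO (hmem' v hv)
  have hcen : p₀ ∈ ball p₀ r := mem_ball_self hr
  have key := Complex.norm_fderiv_le_div_of_mapsTo_ball (R₂ := ε * r / 2) (hd1.sub hd2)
    (fun v hv => by
      have h1 := hnear v hv
      have h2 := hnear p₀ hcen
      rw [dist_eq_norm] at h1 h2
      rw [mem_closedBall, dist_eq_norm]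
      refine (norm_sub_le _ _).trans ?_
      simp only [Pi.sub_apply]
      linarith) hr
  have e1 : fderiv ℂ (fun v => f (v + (p - p₀))) p₀ = fderiv ℂ f p := by
    rw [fderiv_comp_add_right]; simp
  rw [fderiv_sub (hd1.differentiableAt (isOpen_ball.mem_nhds hcen))
    (hd2.differentiableAt (isOpen_ball.mem_nhds hcen)), e1] at key
  rw [dist_eq_norm]
  refine key.trans_lt ?_
  rw [div_lt_iff₀ hr]
  nlinarith [mul_pos hε hr]

/-- Holomorphic dependence of a circle integral on parameters. -/
theorem differentiableOn_circleIntegral [FiniteDimensional ℂ E] {F : E × ℂ → ℂ}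
    {O : Set (E × ℂ)} (hO : IsOpen O) (hF : DifferentiableOn ℂ F O) {U : Set E} {c : ℂ} {r : ℝ}
    (hU : IsOpen U) (hr : 0 ≤ r) (h : U ×ˢ sphere c r ⊆ O) :
    DifferentiableOn ℂ (fun x => ∮ ζ in C(c, r), F (x, ζ)) U := by
  have : ProperSpace E := FiniteDimensional.proper ℂ E
  intro x₀ hx₀
  apply DifferentiableAt.differentiableWithinAt
  obtain ⟨ε, hε, hεU⟩ := Metric.nhds_basis_closedBall.mem_iff.1 (hU.mem_nhds hx₀)
  have hsub : closedBall x₀ ε ×ˢ sphere c r ⊆ O := (prod_mono hεU subset_rfl).trans h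
  have hcf := continuousOn_fderiv_of_differentiableOn hO hF
  obtain ⟨C, hC⟩ := ((isCompact_closedBall x₀ ε).prod (isCompact_sphere c r)).exists_bound_of_continuousOn
    (hcf.mono hsub)
  have hcirc : ∀ θ, circleMap c r θ ∈ sphere c r := fun θ => circleMap_mem_sphere c hr θ
  have hcm : ∀ x ∈ closedBall x₀ ε, Continuous fun θ => F (x, circleMap c r θ) := fun x hx =>
    hF.continuousOn.comp_continuous (by fun_prop) fun θ => hsub ⟨hx, hcirc θ⟩
  have hcd : ∀ x ∈ closedBall x₀ ε, Continuous fun θ => fderiv ℂ F (x, circleMap c r θ) :=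
    fun x hx => hcf.comp_continuous (by fun_prop) fun θ => hsub ⟨hx, hcirc θ⟩
  have hx₀m : x₀ ∈ closedBall x₀ ε := mem_closedBall_self hε.le
  have hderc : Continuous fun θ => deriv (circleMap c r) θ := by
    simp only [deriv_circleMap]; fun_prop
  have key := intervalIntegral.hasFDerivAt_integral_of_dominated_of_fderiv_le (𝕜 := ℂ)
    (μ := MeasureTheory.volume) (a := 0) (b := 2 * Real.pi)
    (F := fun x θ => deriv (circleMap c r) θ • F (x, circleMap c r θ))
    (F' := fun x θ => deriv (circleMap c r) θ •
      (fderiv ℂ F (x, circleMap c r θ)).comp (ContinuousLinearMap.inl ℂ E ℂ))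
    (x₀ := x₀) (s := closedBall x₀ ε) (bound := fun _ => r * (C * ‖ContinuousLinearMap.inl ℂ E ℂ‖))
    (closedBall_mem_nhds x₀ hε)
    (by
      filter_upwards [closedBall_mem_nhds x₀ hε] with x hx
      exact (hderc.smul (hcm x hx)).aestronglyMeasurable)
    ((hderc.smul (hcm x₀ hx₀m)).intervalIntegrable _ _)
    ((hderc.smul ((hcd x₀ hx₀m).clm_comp continuous_const)).aestronglyMeasurable)
    (by
      refine Eventually.of_forall fun θ _ x hx => ?_
      rw [norm_smul]
      have h1 : ‖deriv (circleMap c r) θ‖ = r := by simp [abs_of_nonneg hr]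
      rw [h1]
      refine mul_le_mul_of_nonneg_left ?_ hr
      refine (ContinuousLinearMap.opNorm_comp_le _ _).trans ?_
      exact mul_le_mul_of_nonneg_right (hC _ ⟨hx, hcirc θ⟩) (norm_nonneg _))
    intervalIntegrable_const
    (by
      refine Eventually.of_forall fun θ _ x hx => ?_
      have h1 : HasFDerivAt F (fderiv ℂ F (x, circleMap c r θ)) (x, circleMap c r θ) :=
        (hF.differentiableAt (hO.mem_nhds (hsub ⟨hx, hcirc θ⟩))).hasFDerivAt
      have h2 : HasFDerivAt (fun y : E => (y, circleMap c r θ))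
          (ContinuousLinearMap.inl ℂ E ℂ) x := hasFDerivAt_prodMk_left x _
      exact HasFDerivAt.const_smul (h1.comp x h2) (deriv (circleMap c r) θ))
  exact key.differentiableAt

/-- Directional derivatives of holomorphic functions are holomorphic. -/
theorem differentiableOn_fderiv_apply [FiniteDimensional ℂ V] {f : V → ℂ} {O : Set V}
    (hO : IsOpen O) (hf : DifferentiableOn ℂ f O) (v : V) :
    DifferentiableOn ℂ (fun p => fderiv ℂ f p v) O := by
  intro p₀ hp₀
  apply DifferentiableAt.differentiableWithinAt
  have hcont : Continuous fun q : V × ℂ => q.1 + q.2 • v := by fun_prop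
  have hO' : IsOpen ((fun q : V × ℂ => q.1 + q.2 • v) ⁻¹' O) := hO.preimage hcont
  obtain ⟨A, hA, B, hB, hAB⟩ := mem_nhds_prod_iff.1
    (hO'.mem_nhds (show (p₀, (0 : ℂ)) ∈ _ by simpa using hp₀))
  obtain ⟨ε, hε, hεA⟩ := Metric.mem_nhds_iff.1 hA
  obtain ⟨r, hr, hrB⟩ := Metric.nhds_basis_closedBall.mem_iff.1 hB
  have hsub : ∀ p ∈ ball p₀ ε, ∀ ζ ∈ closedBall (0 : ℂ) r, p + ζ • v ∈ O := fun p hp ζ hζ =>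
    hAB (mk_mem_prod (hεA hp) (hrB hζ))
  have hG : DifferentiableOn ℂ (fun q : V × ℂ => ((q.2 - 0) ^ 2)⁻¹ • f (q.1 + q.2 • v))
      ((fun q : V × ℂ => q.1 + q.2 • v) ⁻¹' O ∩ {q | q.2 ≠ 0}) := by
    refine DifferentiableOn.fun_smul (𝕜' := ℂ) ?_ ?_
    · refine DifferentiableOn.inv (by fun_prop) fun q hq => by simpa using hq.2
    · exact hf.comp (by fun_prop) fun q hq => hq.1
  have hint := differentiableOn_circleIntegral (c := 0) (r := r)
    (hO'.inter (isOpen_ne_fun continuous_snd continuous_const)) hG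
    (isOpen_ball (x := p₀) (ε := ε)) hr.le (by
      rintro ⟨p, ζ⟩ ⟨hp, hζ⟩
      exact ⟨hsub p hp ζ (sphere_subset_closedBall hζ), by
        rintro rfl
        simp at hζ
        exact hr.ne hζ⟩)
  have heq : ∀ p ∈ ball p₀ ε, fderiv ℂ f p v = (2 * Real.pi * Complex.I : ℂ)⁻¹ •
      ∮ ζ in C((0 : ℂ), r), ((ζ - 0) ^ 2)⁻¹ • f (p + ζ • v) := by
    intro p hp
    have hpO : p ∈ O := by simpa using hsub p hp 0 (mem_closedBall_self hr.le)
    have hl : Continuous fun ζ : ℂ => p + ζ • v := by fun_prop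
    rw [Complex.two_pi_I_inv_smul_circleIntegral_sub_sq_inv_smul_of_differentiable
      (hO.preimage hl) (fun ζ hζ => hsub p hp ζ hζ)
      (f := fun ζ => f (p + ζ • v)) (hf.comp (by fun_prop) fun ζ hζ => hζ) (mem_ball_self hr)]
    have h1 : HasDerivAt (fun ζ : ℂ => p + ζ • v) v 0 := by
      simpa using ((hasDerivAt_id (0 : ℂ)).smul_const v).const_add p
    have h2 : HasFDerivAt f (fderiv ℂ f p) (p + (0 : ℂ) • v) := by
      simpa using (hf.differentiableAt (hO.mem_nhds hpO)).hasFDerivAt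
    exact (h2.comp_hasDerivAt (0 : ℂ) h1).deriv.symm
  refine DifferentiableAt.congr_of_eventuallyEq
    ((hint.differentiableAt (ball_mem_nhds p₀ hε)).const_smul
      ((2 * Real.pi * Complex.I : ℂ)⁻¹)) ?_
  filter_upwards [ball_mem_nhds p₀ hε] with p hp
  exact heq p hp

end SeveralVariables

section Zeros

open Metric Set

/-- `s` is the multiset of zeros of `h` in the closed disc of center `c` and radius `r`, and all
of these lie in the open disc. -/
def IsZeroMultiset (h : ℂ → ℂ) (c : ℂ) (r : ℝ) (s : Multiset ℂ) : Prop :=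
  (∀ y ∈ s, y ∈ ball c r) ∧ ∃ (u : ℂ → ℂ) (O : Set ℂ), IsOpen O ∧ closedBall c r ⊆ O ∧
    DifferentiableOn ℂ u O ∧ (∀ y ∈ closedBall c r, u y ≠ 0) ∧
    ∀ y ∈ O, h y = (s.map fun a => y - a).prod * u y

theorem multiset_prod_sub_eq_zero_iff {s : Multiset ℂ} {y : ℂ} :
    (s.map fun a => y - a).prod = 0 ↔ y ∈ s := by
  rw [Multiset.prod_eq_zero_iff, Multiset.mem_map]
  constructor
  · rintro ⟨a, ha, h⟩
    rwa [sub_eq_zero.1 h]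
  · exact fun h => ⟨y, h, sub_self y⟩

theorem IsZeroMultiset.mem_iff {h : ℂ → ℂ} {c : ℂ} {r : ℝ} {s : Multiset ℂ}
    (hs : IsZeroMultiset h c r s) {y : ℂ} (hy : y ∈ closedBall c r) : y ∈ s ↔ h y = 0 := by
  obtain ⟨-, u, O, -, hO, -, hu, hh⟩ := hs
  rw [hh y (hO hy), mul_eq_zero, multiset_prod_sub_eq_zero_iff]
  simp [hu y hy]

theorem finite_zeros_closedBall {h : ℂ → ℂ} {c : ℂ} {r : ℝ} {O : Set ℂ} (hr : 0 ≤ r)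
    (hO : IsOpen O) (hrO : closedBall c r ⊆ O) (hh : DifferentiableOn ℂ h O)
    (hne : ∀ y ∈ sphere c r, h y ≠ 0) : {y ∈ closedBall c r | h y = 0}.Finite := by
  by_contra hinf
  obtain ⟨a, ha, hacc⟩ := Set.Infinite.exists_accPt_of_subset_isCompact hinf
    (isCompact_closedBall c r) (sep_subset _ _)
  rw [accPt_iff_frequently_nhdsNE] at hacc
  have han : AnalyticOnNhd ℂ h (closedBall c r) := (hh.analyticOnNhd hO).mono hrO
  have := han.eqOn_zero_of_preconnected_of_frequently_eq_zero
    (convex_closedBall c r).isPreconnected ha (hacc.mono fun z hz => hz.2)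
  obtain ⟨w, hw⟩ : (sphere c r).Nonempty := NormedSpace.sphere_nonempty.mpr hr
  exact hne w hw (this (sphere_subset_closedBall hw))

theorem exists_factor_at_zero {h : ℂ → ℂ} {O : Set ℂ} (hO : IsOpen O)
    (hh : DifferentiableOn ℂ h O) {a : ℂ} (ha : a ∈ O) (hne : ¬∀ᶠ z in 𝓝 a, h z = 0) :
    ∃ (n : ℕ) (k : ℂ → ℂ), DifferentiableOn ℂ k O ∧ k a ≠ 0 ∧
      ∀ z ∈ O, h z = (z - a) ^ n * k z := by
  have han : AnalyticAt ℂ h a := hh.analyticAt (hO.mem_nhds ha)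
  obtain ⟨n, g, hg, hga, hgh⟩ := han.exists_eventuallyEq_pow_smul_nonzero_iff.2 hne
  classical
  let k : ℂ → ℂ := Function.update (fun z => h z / (z - a) ^ n) a (g a)
  have hkg : k =ᶠ[𝓝 a] g := by
    filter_upwards [hgh] with z hz
    by_cases hza : z = a
    · subst hza; simp [k]
    · have : (z - a) ^ n ≠ 0 := pow_ne_zero _ (sub_ne_zero.2 hza)
      simp only [k, Function.update_of_ne hza, hz, smul_eq_mul]
      field_simp
  refine ⟨n, k, fun z hz => ?_, by simpa [k] using hga, fun z hz => ?_⟩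
  · apply DifferentiableAt.differentiableWithinAt
    by_cases hza : z = a
    · subst hza
      exact hg.differentiableAt.congr_of_eventuallyEq hkg
    · have h1 : DifferentiableAt ℂ (fun z => h z / (z - a) ^ n) z :=
        (hh.differentiableAt (hO.mem_nhds hz)).div (by fun_prop)
          (pow_ne_zero _ (sub_ne_zero.2 hza))
      refine h1.congr_of_eventuallyEq ?_
      filter_upwards [isOpen_ne.mem_nhds hza] with w hw
      simp [k, Function.update_of_ne hw]
  · by_cases hza : z = a
    · subst hza
      have := hgh.self_of_nhds
      simpa [k] using this
    · have : (z - a) ^ n ≠ 0 := pow_ne_zero _ (sub_ne_zero.2 hza)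
      simp only [k, Function.update_of_ne hza]
      field_simp

theorem exists_isZeroMultiset {h : ℂ → ℂ} {c : ℂ} {r : ℝ} {O : Set ℂ} (hr : 0 ≤ r)
    (hO : IsOpen O) (hrO : closedBall c r ⊆ O) (hh : DifferentiableOn ℂ h O)
    (hne : ∀ y ∈ sphere c r, h y ≠ 0) : ∃ s, IsZeroMultiset h c r s := by
  have hfin := finite_zeros_closedBall hr hO hrO hh hne
  have key : ∀ (Z : Finset ℂ) (h : ℂ → ℂ), DifferentiableOn ℂ h O →
      (∀ y ∈ closedBall c r, h y = 0 ↔ y ∈ Z) → (∀ y ∈ Z, y ∈ ball c r) →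
      ∃ s, IsZeroMultiset h c r s := by
    intro Z
    induction Z using Finset.induction_on with
    | empty =>
      intro h hh hZ _
      exact ⟨0, by simp, h, O, hO, hrO, hh, fun y hy => by simp [hZ y hy], by simp⟩
    | insert a Z haZ ih =>
      intro h hh hZ hball
      have hab : a ∈ ball c r := hball a (Finset.mem_insert_self a Z)
      have hacb := ball_subset_closedBall hab
      have hnz : ¬∀ᶠ z in 𝓝 a, h z = 0 := by
        intro hev
        have hinf : Set.Infinite (↑(insert a Z) : Set ℂ) := by
          refine infinite_of_mem_nhds a ?_
          filter_upwards [hev, isOpen_ball.mem_nhds hab] with z hz hzb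
          exact_mod_cast (hZ z (ball_subset_closedBall hzb)).1 hz
        exact hinf (Finset.finite_toSet _)
      obtain ⟨n, k, hk, hka, hkh⟩ := exists_factor_at_zero hO hh (hrO hacb) hnz
      obtain ⟨s, hs, u, O', hO', hcO', hu, hu0, hsk⟩ := ih k hk (fun y hy => by
        have h1 := hZ y hy
        rw [hkh y (hrO hy), Finset.mem_insert] at h1
        by_cases hya : y = a
        · subst hya; simp [hka, haZ]
        · have : (y - a) ^ n ≠ 0 := pow_ne_zero _ (sub_ne_zero.2 hya)
          simpa [this, hya] using h1) (fun y hy => hball y (Finset.mem_insert_of_mem hy))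
      refine ⟨Multiset.replicate n a + s, ?_, u, O ∩ O', hO.inter hO', subset_inter hrO hcO',
        hu.mono inter_subset_right, hu0, ?_⟩
      · intro y hy
        rcases Multiset.mem_add.1 hy with hy | hy
        · rwa [Multiset.eq_of_mem_replicate hy]
        · exact hs y hy
      · intro y hy
        rw [hkh y hy.1, hsk y hy.2]
        simp [mul_assoc]
  refine key hfin.toFinset h hh (fun y hy => by simp [mem_closedBall.1 hy]) fun y hy => ?_
  rw [Set.Finite.mem_toFinset] at hy
  have hy1 := mem_closedBall.1 hy.1
  refine mem_ball.2 (lt_of_le_of_ne hy1 fun h' => hne y h' hy.2)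

theorem IsZeroMultiset.restrict {h : ℂ → ℂ} {c : ℂ} {r : ℝ} {s : Multiset ℂ}
    (hs : IsZeroMultiset h c r s) {c' : ℂ} {r' : ℝ} (hsub : closedBall c' r' ⊆ closedBall c r)
    (hne : ∀ y ∈ sphere c' r', h y ≠ 0) [DecidablePred (· ∈ ball c' r')] :
    IsZeroMultiset h c' r' (s.filter (· ∈ ball c' r')) := by
  obtain ⟨hsb, u, O, hO, hrO, hu, hu0, hh⟩ := hs
  refine ⟨fun y hy => (Multiset.mem_filter.1 hy).2,
    fun y => ((s.filter fun a => ¬ a ∈ ball c' r').map fun a => y - a).prod * u y, O, hO,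
    hsub.trans hrO, ?_, ?_, ?_⟩
  · refine DifferentiableOn.mul ?_ hu
    generalize (s.filter fun a => ¬ a ∈ ball c' r') = t
    induction t using Multiset.induction_on with
    | empty => simp
    | cons a t ih =>
      simp only [Multiset.map_cons, Multiset.prod_cons]
      exact DifferentiableOn.mul (by fun_prop) ih
  · intro y hy
    refine mul_ne_zero ?_ (hu0 y (hsub hy))
    rw [Ne, multiset_prod_sub_eq_zero_iff, Multiset.mem_filter]
    rintro ⟨hys, hyb⟩
    have hysph : y ∈ sphere c' r' :=
      le_antisymm (mem_closedBall.1 hy) (not_lt.1 hyb)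
    refine hne y hysph ?_
    rw [hh y (hrO (hsub hy)), multiset_prod_sub_eq_zero_iff.2 hys, zero_mul]
  · intro y hy
    rw [hh y hy, ← mul_assoc, ← Multiset.prod_add, ← Multiset.map_add, Multiset.filter_add_not]

/-- The sum of the values of a holomorphic function over the zeros of `h` as a contour integral. -/
theorem IsZeroMultiset.sum_eq {h F : ℂ → ℂ} {c : ℂ} {r : ℝ} {s : Multiset ℂ} (hr : 0 < r)
    (hs : IsZeroMultiset h c r s) (hF : DifferentiableOn ℂ F (closedBall c r)) :
    ∮ ζ in C(c, r), F ζ * (deriv h ζ / h ζ) = 2 * Real.pi * Complex.I * (s.map F).sum := by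
  obtain ⟨hsb, u, O, hO, hrO, hu, hu0, hh⟩ := hs
  have hud : DifferentiableOn ℂ (deriv u) O := hu.deriv hO
  induction s using Multiset.induction_on generalizing h with
  | empty =>
    simp only [Multiset.map_zero, Multiset.sum_zero, mul_zero]
    have : ∮ ζ in C(c, r), F ζ * (deriv h ζ / h ζ) = ∮ ζ in C(c, r), F ζ * (deriv u ζ / u ζ) := by
      refine circleIntegral.integral_congr hr.le fun ζ hζ => ?_
      have hev : h =ᶠ[𝓝 ζ] u := by
        filter_upwards [hO.mem_nhds (hrO (sphere_subset_closedBall hζ))] with z hz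
        simpa using hh z hz
      simp only [hev.deriv_eq, hev.self_of_nhds]
    rw [this]
    refine DiffContOnCl.circleIntegral_eq_zero hr.le (DifferentiableOn.diffContOnCl ?_)
    rw [closure_ball c hr.ne']
    exact hF.mul ((hud.mono hrO).div (hu.mono hrO) hu0)
  | cons a s ih =>
    have hab := hsb a (Multiset.mem_cons_self a s)
    have hsb' : ∀ y ∈ s, y ∈ ball c r := fun y hy => hsb y (Multiset.mem_cons_of_mem hy)
    set h₁ : ℂ → ℂ := fun y => (s.map fun a => y - a).prod * u y with hh₁
    have ih₁ := ih (h := h₁) hsb' fun y _ => rfl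
    have hd₁ : DifferentiableOn ℂ h₁ O := by
      refine DifferentiableOn.mul ?_ hu
      clear * -
      induction s using Multiset.induction_on with
      | empty => simp
      | cons a t ih =>
        simp only [Multiset.map_cons, Multiset.prod_cons]
        exact DifferentiableOn.mul (by fun_prop) ih
    have hne₁ : ∀ ζ ∈ sphere c r, h₁ ζ ≠ 0 := by
      intro ζ hζ
      refine mul_ne_zero ?_ (hu0 ζ (sphere_subset_closedBall hζ))
      rw [Ne, multiset_prod_sub_eq_zero_iff]
      intro hmem
      exact (mem_ball.1 (hsb' ζ hmem)).ne (mem_sphere.1 hζ)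
    have hnea : ∀ ζ ∈ sphere c r, ζ - a ≠ 0 := by
      intro ζ hζ h0
      rw [sub_eq_zero.1 h0] at hζ
      exact (mem_ball.1 hab).ne (mem_sphere.1 hζ)
    have hsO : sphere c r ⊆ O := sphere_subset_closedBall.trans hrO
    have hcong : ∮ ζ in C(c, r), F ζ * (deriv h ζ / h ζ) =
        ∮ ζ in C(c, r), ((ζ - a)⁻¹ • F ζ + F ζ * (deriv h₁ ζ / h₁ ζ)) := by
      refine circleIntegral.integral_congr hr.le fun ζ hζ => ?_
      have hev : h =ᶠ[𝓝 ζ] fun z => (z - a) * h₁ z := by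
        filter_upwards [hO.mem_nhds (hsO hζ)] with z hz
        rw [hh z hz]
        simp [hh₁, mul_assoc]
      have hdh : DifferentiableAt ℂ h₁ ζ := hd₁.differentiableAt (hO.mem_nhds (hsO hζ))
      have hderiv : deriv h ζ = h₁ ζ + (ζ - a) * deriv h₁ ζ := by
        rw [hev.deriv_eq]
        have : HasDerivAt (fun z => (z - a) * h₁ z) (1 * h₁ ζ + (ζ - a) * deriv h₁ ζ) ζ :=
          ((hasDerivAt_id ζ).sub_const a).mul hdh.hasDerivAt
        rw [this.deriv, one_mul]
      have h1 := hne₁ ζ hζ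
      have h2 := hnea ζ hζ
      simp only [hderiv, hev.self_of_nhds, smul_eq_mul]
      field_simp
    have hFc : ContinuousOn F (sphere c r) := hF.continuousOn.mono sphere_subset_closedBall
    rw [hcong, circleIntegral.integral_add, hF.circleIntegral_sub_inv_smul hab, ih₁]
    · simp [mul_add]
    · refine ContinuousOn.circleIntegrable hr.le ?_
      exact ContinuousOn.smul (ContinuousOn.inv₀ (by fun_prop) hnea) hFc
    · refine ContinuousOn.circleIntegrable hr.le ?_
      exact hFc.mul ((((hd₁.deriv hO).continuousOn.mono hsO)).div
        (hd₁.continuousOn.mono hsO) hne₁)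

end Zeros

section Charts

open Metric Set

variable {E : Type*} [NormedAddCommGroup E] [NormedSpace ℂ E]

theorem isOpen_fibre {A : Type*} [TopologicalSpace A] {O : Set (A × ℂ)} (hO : IsOpen O) (x : A) :
    IsOpen {y | (x, y) ∈ O} :=
  hO.preimage (by fun_prop : Continuous fun y : ℂ => (x, y))

/-- `h` is holomorphic near `U × closedBall c r` and has no zeros in `U × sphere c r`. -/
structure IsChart (h : E × ℂ → ℂ) (O : Set (E × ℂ)) (U : Set E) (c : ℂ) (r : ℝ) : Prop where
  isOpen_source : IsOpen O
  isOpen_base : IsOpen U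
  radius_pos : 0 < r
  subset : U ×ˢ closedBall c r ⊆ O
  differentiableOn : DifferentiableOn ℂ h O
  ne_zero : ∀ x ∈ U, ∀ y ∈ sphere c r, h (x, y) ≠ 0

namespace IsChart

variable {h : E × ℂ → ℂ} {O : Set (E × ℂ)} {U : Set E} {c : ℂ} {r : ℝ}

theorem mono (H : IsChart h O U c r) {U' : Set E} (hU' : IsOpen U') (hsub : U' ⊆ U) :
    IsChart h O U' c r :=
  ⟨H.1, hU', H.3, (prod_mono_left hsub).trans H.4, H.5, fun x hx => H.6 x (hsub hx)⟩

theorem differentiableOn_fibre (_H : IsChart h O U c r) {F : E × ℂ → ℂ}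
    (hF : DifferentiableOn ℂ F O) (x : E) :
    DifferentiableOn ℂ (fun y => F (x, y)) {y | (x, y) ∈ O} :=
  hF.comp (by fun_prop) fun _ hy => hy

theorem closedBall_subset (H : IsChart h O U c r) {x : E} (hx : x ∈ U) :
    closedBall c r ⊆ {y | (x, y) ∈ O} :=
  fun _ hy => H.subset ⟨hx, hy⟩

theorem exists_isZeroMultiset (H : IsChart h O U c r) {x : E} (hx : x ∈ U) :
    ∃ s, IsZeroMultiset (fun y => h (x, y)) c r s :=
  _root_.exists_isZeroMultiset H.radius_pos.le (isOpen_fibre H.isOpen_source x) (H.closedBall_subset hx)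
    (H.differentiableOn_fibre H.differentiableOn x) (H.ne_zero x hx)

theorem differentiableOn_sum [FiniteDimensional ℂ E] (H : IsChart h O U c r)
    {s : E → Multiset ℂ} (hs : ∀ x ∈ U, IsZeroMultiset (fun y => h (x, y)) c r (s x))
    {F : E × ℂ → ℂ} (hF : DifferentiableOn ℂ F O) :
    DifferentiableOn ℂ (fun x => ((s x).map fun y => F (x, y)).sum) U := by
  set O' : Set (E × ℂ) := O ∩ {p | h p ≠ 0} with hO'
  have hO'o : IsOpen O' :=
    H.differentiableOn.continuousOn.isOpen_inter_preimage H.isOpen_source isOpen_ne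
  have hI := differentiableOn_circleIntegral (F := fun p => F p * (fderiv ℂ h p (0, 1) * (h p)⁻¹))
    hO'o (DifferentiableOn.mul (hF.mono inter_subset_left) (DifferentiableOn.mul
      ((differentiableOn_fderiv_apply H.isOpen_source H.differentiableOn _).mono
        inter_subset_left) ((H.differentiableOn.mono inter_subset_left).fun_inv fun p hp => hp.2)))
    H.isOpen_base H.radius_pos.le (c := c) (r := r) (fun p hp =>
      ⟨H.subset ⟨hp.1, sphere_subset_closedBall hp.2⟩, H.ne_zero p.1 hp.1 p.2 hp.2⟩)
  refine (hI.const_mul (2 * Real.pi * Complex.I)⁻¹).congr fun x hx => ?_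
  have h2 := (hs x hx).sum_eq H.radius_pos (F := fun y => F (x, y))
    ((H.differentiableOn_fibre hF x).mono (H.closedBall_subset hx))
  have hpi : (2 * Real.pi * Complex.I : ℂ) ≠ 0 := Complex.two_pi_I_ne_zero
  rw [eq_inv_mul_iff_mul_eq₀ hpi, ← h2]
  refine circleIntegral.integral_congr H.radius_pos.le fun ζ hζ => ?_
  have hd : HasFDerivAt h (fderiv ℂ h (x, ζ)) (x, ζ) :=
    (H.differentiableOn.differentiableAt (H.isOpen_source.mem_nhds
      (H.subset ⟨hx, sphere_subset_closedBall hζ⟩))).hasFDerivAt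
  have h3 : HasDerivAt (fun y => h (x, y)) (fderiv ℂ h (x, ζ) (0, 1)) ζ :=
    hd.comp_hasDerivAt ζ ((hasDerivAt_const ζ x).prodMk (hasDerivAt_id ζ))
  simp only [h3.deriv, div_eq_mul_inv]

theorem eventually_card_eq [FiniteDimensional ℂ E] (H : IsChart h O U c r)
    {s : E → Multiset ℂ} (hs : ∀ x ∈ U, IsZeroMultiset (fun y => h (x, y)) c r (s x))
    {x : E} (hx : x ∈ U) : ∀ᶠ x' in 𝓝 x, (s x').card = (s x).card := by
  have h1 := (H.differentiableOn_sum hs (F := fun _ => 1) (differentiableOn_const 1)).continuousOn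
  have h2 := h1.continuousAt (H.isOpen_base.mem_nhds hx)
  simp only [Multiset.map_const', Multiset.sum_replicate, nsmul_eq_mul, mul_one] at h2
  have h3 := Metric.continuousAt_iff'.1 h2 1 one_pos
  filter_upwards [h3] with x' hx'
  rw [dist_eq_norm, ← Int.cast_natCast, ← Int.cast_natCast (s x).card, ← Int.cast_sub,
    Complex.norm_intCast] at hx'
  have : |((s x').card : ℤ) - (s x).card| < 1 := by exact_mod_cast hx'
  have := Int.abs_lt_one_iff.1 this
  omega

theorem exists_card_eq [FiniteDimensional ℂ E] (H : IsChart h O U c r)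
    (hU : IsPreconnected U) {s : E → Multiset ℂ}
    (hs : ∀ x ∈ U, IsZeroMultiset (fun y => h (x, y)) c r (s x)) :
    ∃ m, ∀ x ∈ U, (s x).card = m := by
  rcases U.eq_empty_or_nonempty with rfl | ⟨x₀, hx₀⟩
  · exact ⟨0, by simp⟩
  · refine ⟨(s x₀).card, fun x hx => ?_⟩
    refine hU.constant_of_mapsTo (f := fun x => (s x).card) (T := univ)
      IsDiscrete.univ ?_ (mapsTo_univ _ _) hx hx₀
    intro x hx
    refine ContinuousAt.continuousWithinAt ?_
    exact (tendsto_const_nhds (x := (s x).card)).congr'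
      ((H.eventually_card_eq hs hx).mono fun _ h => h.symm)

/-- The zeros of the functions `h (x, ·)`, listed with multiplicity. -/
theorem exists_roots [FiniteDimensional ℂ E] (H : IsChart h O U c r) (hU : IsPreconnected U) :
    ∃ (m : ℕ) (y : E → Fin m → ℂ), (∀ x ∈ U, ∀ l, y x l ∈ ball c r) ∧
      (∀ x ∈ U, ∀ w ∈ closedBall c r, h (x, w) = 0 ↔ ∃ l, y x l = w) ∧
      ∀ F : E × ℂ → ℂ, DifferentiableOn ℂ F O →
        DifferentiableOn ℂ (fun x => ∑ l, F (x, y x l)) U := by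
  classical
  have hex : ∀ x, ∃ s, x ∈ U → IsZeroMultiset (fun y => h (x, y)) c r s := fun x => by
    by_cases hx : x ∈ U
    · obtain ⟨s, hs⟩ := H.exists_isZeroMultiset hx
      exact ⟨s, fun _ => hs⟩
    · exact ⟨0, fun h => absurd h hx⟩
  choose s hs using hex
  obtain ⟨m, hm⟩ := H.exists_card_eq hU hs
  have hex' : ∀ x, ∃ y : Fin m → ℂ, x ∈ U → s x = Multiset.map y Finset.univ.val := fun x => by
    by_cases hx : x ∈ U
    · obtain ⟨l, hl⟩ := Quot.exists_rep (s x)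
      have hl' : l.length = m := by rw [← hm x hx, ← hl]; rfl
      subst hl'
      refine ⟨l.get, fun _ => ?_⟩
      rw [Fin.univ_val_map, List.ofFn_get]
      exact hl.symm
    · exact ⟨0, fun h => absurd h hx⟩
  choose y hy using hex'
  refine ⟨m, y, fun x hx l => ?_, fun x hx w hw => ?_, fun F hF => ?_⟩
  · exact (hs x hx).1 _ (by rw [hy x hx]; exact Multiset.mem_map_of_mem _ (Finset.mem_univ l))
  · rw [← (hs x hx).mem_iff hw, hy x hx]
    simp
  · refine (H.differentiableOn_sum hs hF).congr fun x hx => ?_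
    rw [hy x hx, Multiset.map_map]
    rfl

end IsChart

/-- Newton's identities express products through power sums. -/
theorem differentiableOn_prod_of_sum_pow {m : ℕ} {U : Set E} {z : E → Fin m → ℂ}
    (hz : ∀ j, DifferentiableOn ℂ (fun x => ∑ l, z x l ^ j) U) :
    DifferentiableOn ℂ (fun x => ∏ l, z x l) U := by
  have key : ∀ k, DifferentiableOn ℂ
      (fun x => MvPolynomial.aeval (z x) (MvPolynomial.esymm (Fin m) ℂ k)) U := by
    intro k
    induction k using Nat.strong_induction_on with
    | _ k ih =>
      rcases Nat.eq_zero_or_pos k with rfl | hk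
      · simp
      · have hk0 : (k : ℂ) ≠ 0 := by exact_mod_cast hk.ne'
        have hN : ∀ x, MvPolynomial.aeval (z x) (MvPolynomial.esymm (Fin m) ℂ k) =
            (k : ℂ)⁻¹ * ((-1) ^ (k + 1) * ∑ a ∈ Finset.HasAntidiagonal.antidiagonal k with a.1 < k,
              (-1) ^ a.1 * MvPolynomial.aeval (z x) (MvPolynomial.esymm (Fin m) ℂ a.1) *
                ∑ l, z x l ^ a.2) := by
          intro x
          rw [eq_inv_mul_iff_mul_eq₀ hk0]
          have := congrArg (MvPolynomial.aeval (z x)) (MvPolynomial.mul_esymm_eq_sum (Fin m) ℂ k)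
          simpa [MvPolynomial.psum, map_sum] using this
        simp only [hN]
        refine DifferentiableOn.const_mul (DifferentiableOn.const_mul
          (DifferentiableOn.fun_sum fun a ha => ?_) _) _
        exact ((ih a.1 (Finset.mem_filter.1 ha).2).const_mul _).mul (hz a.2)
  refine (key m).congr fun x _ => ?_
  have : Finset.powersetCard m (Finset.univ : Finset (Fin m)) = {Finset.univ} := by
    have := Finset.powersetCard_self (Finset.univ : Finset (Fin m))
    rwa [Finset.card_univ, Fintype.card_fin] at this
  rw [MvPolynomial.esymm, this]
  simp

end Charts

section Projection

open Metric Set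

/-- Several finite families of numbers: one of them vanishes identically iff sufficiently many
products of generic linear combinations vanish. -/
theorem exists_forall_eq_zero_iff_prod_eq_zero {m q : ℕ} (a : Fin m → Fin q → ℂ) :
    (∃ l, ∀ i, a l i = 0) ↔ ∀ s : Fin (m * q + 1), ∏ l, ∑ i : Fin q, ((s : ℕ) : ℂ) ^ (i : ℕ) * a l i = 0 := by
  constructor
  · rintro ⟨l, hl⟩ s
    exact Finset.prod_eq_zero (Finset.mem_univ l) (by simp [hl])
  · intro h
    let p : Fin m → Polynomial ℂ := fun l => ∑ i, Polynomial.C (a l i) * Polynomial.X ^ (i : ℕ)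
    have hdeg : ∀ l, (p l).natDegree ≤ q := fun l =>
      Polynomial.natDegree_sum_le_of_forall_le _ _ fun i _ =>
        (Polynomial.natDegree_C_mul_X_pow_le _ _).trans i.2.le
    have hp : ∏ l, p l = 0 := by
      refine Polynomial.eq_zero_of_natDegree_lt_card_of_eval_eq_zero (ι := Fin (m * q + 1))
        _ (f := fun s => ((s : ℕ) : ℂ)) (fun s t hst => ?_) (fun s => ?_) ?_
      · simpa [Fin.ext_iff] using hst
      · rw [Polynomial.eval_prod, ← h s]
        refine Finset.prod_congr rfl fun l _ => ?_
        simp only [p, Polynomial.eval_finsetSum, Polynomial.eval_mul, Polynomial.eval_C,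
          Polynomial.eval_pow, Polynomial.eval_X]
        exact Finset.sum_congr rfl fun i _ => mul_comm _ _
      · rw [Fintype.card_fin, Nat.lt_succ_iff]
        refine (Polynomial.natDegree_prod_le _ _).trans ?_
        refine (Finset.sum_le_card_nsmul _ _ q fun l _ => hdeg l).trans ?_
        simp
    obtain ⟨l, -, hl⟩ := Finset.prod_eq_zero_iff.1 hp
    refine ⟨l, fun i => ?_⟩
    have := congrArg (fun P => Polynomial.coeff P (i : ℕ)) hl
    simpa [p, Polynomial.finsetSum_coeff, Polynomial.coeff_X_pow, Fin.val_inj] using this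

variable {E : Type*} [NormedAddCommGroup E] [NormedSpace ℂ E]
  {h : E × ℂ → ℂ} {O : Set (E × ℂ)} {U : Set E} {c : ℂ} {r : ℝ}

theorem differentiableOn_prod_of_sum {m : ℕ} {y : E → Fin m → ℂ}
    (hy : ∀ F : E × ℂ → ℂ, DifferentiableOn ℂ F O →
      DifferentiableOn ℂ (fun x => ∑ l, F (x, y x l)) U)
    {F : E × ℂ → ℂ} (hF : DifferentiableOn ℂ F O) :
    DifferentiableOn ℂ (fun x => ∏ l, F (x, y x l)) U :=
  differentiableOn_prod_of_sum_pow fun j => hy (fun p => F p ^ j) (hF.fun_pow j)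

theorem IsChart.exists_projection_equations [FiniteDimensional ℂ E] (H : IsChart h O U c r)
    (hU : IsPreconnected U) {q : ℕ} {g : Fin q → E × ℂ → ℂ}
    (hg : ∀ i, DifferentiableOn ℂ (g i) O) (hgh : ∀ p ∈ O, (∀ i, g i p = 0) → h p = 0) :
    ∃ (m : ℕ) (y : E → Fin m → ℂ), (∀ x ∈ U, ∀ l, y x l ∈ ball c r) ∧
      (∀ x ∈ U, ∀ l, h (x, y x l) = 0) ∧
      (∀ t : ℂ, DifferentiableOn ℂ (fun x => ∏ l, ∑ i : Fin q, t ^ (i : ℕ) * g i (x, y x l)) U) ∧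
      ∀ x ∈ U, (∃ w ∈ ball c r, ∀ i, g i (x, w) = 0) ↔
        ∀ s : Fin (m * q + 1), ∏ l, ∑ i : Fin q, ((s : ℕ) : ℂ) ^ (i : ℕ) * g i (x, y x l) = 0 := by
  obtain ⟨m, y, hyb, hy0, hyd⟩ := H.exists_roots hU
  refine ⟨m, y, hyb, fun x hx l => ?_, fun t => ?_, fun x hx => ?_⟩
  · exact (hy0 x hx _ (ball_subset_closedBall (hyb x hx l))).2 ⟨l, rfl⟩
  · exact differentiableOn_prod_of_sum hyd (F := fun p => ∑ i : Fin q, t ^ (i : ℕ) * g i p)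
      (DifferentiableOn.fun_sum fun i _ => (hg i).const_mul _)
  · rw [← exists_forall_eq_zero_iff_prod_eq_zero fun l i => g i (x, y x l)]
    constructor
    · rintro ⟨w, hw, hwg⟩
      have hwO : (x, w) ∈ O := H.subset ⟨hx, ball_subset_closedBall hw⟩
      obtain ⟨l, hl⟩ := (hy0 x hx w (ball_subset_closedBall hw)).1 (hgh _ hwO hwg)
      exact ⟨l, fun i => by rw [hl]; exact hwg i⟩
    · rintro ⟨l, hl⟩
      exact ⟨y x l, hyb x hx l, hl⟩

end Projection

section Algebraicity

open Metric Set

variable {n : ℕ}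

/-- The function `f` satisfies a single nontrivial polynomial relation on `U`. -/
def AlgOn (U : Set (Fin n → ℂ)) (f : (Fin n → ℂ) → ℂ) : Prop :=
  ∃ P : Polynomial (MvPolynomial (Fin n) ℂ), P ≠ 0 ∧
    ∀ x ∈ U, Polynomial.eval₂ (MvPolynomial.eval x) (f x) P = 0

/-- Polynomials as functions on `U`. -/
noncomputable def evalOn (U : Set (Fin n → ℂ)) : MvPolynomial (Fin n) ℂ →+* (U → ℂ) :=
  RingHom.pi fun x : U => MvPolynomial.eval x.1

theorem eval₂_evalOn_apply (U : Set (Fin n → ℂ)) (f : U → ℂ)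
    (P : Polynomial (MvPolynomial (Fin n) ℂ)) (x : U) :
    Polynomial.eval₂ (evalOn U) f P x = Polynomial.eval₂ (MvPolynomial.eval x.1) (f x) P :=
  Polynomial.hom_eval₂ P (evalOn U) (Pi.evalRingHom (fun _ => ℂ) x) f

theorem algOn_iff_isAlgebraic {U : Set (Fin n → ℂ)} {f : (Fin n → ℂ) → ℂ} :
    AlgOn U f ↔ @IsAlgebraic (MvPolynomial (Fin n) ℂ) (U → ℂ) _ _ (evalOn U).toAlgebra
      (fun x => f x) := by
  let _ := (evalOn U).toAlgebra
  refine exists_congr fun P => and_congr_right fun _ => ?_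
  rw [Polynomial.aeval_def, funext_iff]
  change _ ↔ ∀ x, Polynomial.eval₂ (evalOn U) (fun x : U => f x) P x = 0
  simp [eval₂_evalOn_apply]

theorem AlgOn.mono {U U' : Set (Fin n → ℂ)} {f : (Fin n → ℂ) → ℂ} (h : AlgOn U f)
    (hU : U' ⊆ U) : AlgOn U' f := by
  obtain ⟨P, hP, hPf⟩ := h
  exact ⟨P, hP, fun x hx => hPf x (hU hx)⟩

theorem AlgOn.union {U U' : Set (Fin n → ℂ)} {f : (Fin n → ℂ) → ℂ} (h : AlgOn U f)
    (h' : AlgOn U' f) : AlgOn (U ∪ U') f := by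
  obtain ⟨P, hP, hPf⟩ := h
  obtain ⟨P', hP', hPf'⟩ := h'
  refine ⟨P * P', mul_ne_zero hP hP', fun x hx => ?_⟩
  rw [Polynomial.eval₂_mul]
  rcases hx with hx | hx
  · rw [hPf x hx, zero_mul]
  · rw [hPf' x hx, mul_zero]

theorem AlgOn.add {U : Set (Fin n → ℂ)} {f g : (Fin n → ℂ) → ℂ} (hf : AlgOn U f)
    (hg : AlgOn U g) : AlgOn U fun x => f x + g x := by
  let _ := (evalOn U).toAlgebra
  exact algOn_iff_isAlgebraic.2 ((algOn_iff_isAlgebraic.1 hf).add (algOn_iff_isAlgebraic.1 hg))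

theorem AlgOn.mul {U : Set (Fin n → ℂ)} {f g : (Fin n → ℂ) → ℂ} (hf : AlgOn U f)
    (hg : AlgOn U g) : AlgOn U fun x => f x * g x := by
  let _ := (evalOn U).toAlgebra
  exact algOn_iff_isAlgebraic.2 ((algOn_iff_isAlgebraic.1 hf).mul (algOn_iff_isAlgebraic.1 hg))

theorem algOn_const (U : Set (Fin n → ℂ)) (c : ℂ) : AlgOn U fun _ => c :=
  ⟨Polynomial.X - Polynomial.C (MvPolynomial.C c), Polynomial.X_sub_C_ne_zero _, by simp⟩

theorem AlgOn.sum {ι : Type*} {U : Set (Fin n → ℂ)} {f : ι → (Fin n → ℂ) → ℂ} {s : Finset ι}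
    (hf : ∀ i ∈ s, AlgOn U (f i)) : AlgOn U fun x => ∑ i ∈ s, f i x := by
  classical
  induction s using Finset.induction_on with
  | empty => simpa using algOn_const U 0
  | insert a s ha ih =>
    simp only [Finset.sum_insert ha]
    exact (hf a (Finset.mem_insert_self a s)).add
      (ih fun i hi => hf i (Finset.mem_insert_of_mem hi))

theorem AlgOn.prod {ι : Type*} {U : Set (Fin n → ℂ)} {f : ι → (Fin n → ℂ) → ℂ} {s : Finset ι}
    (hf : ∀ i ∈ s, AlgOn U (f i)) : AlgOn U fun x => ∏ i ∈ s, f i x := by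
  classical
  induction s using Finset.induction_on with
  | empty => simpa using algOn_const U 1
  | insert a s ha ih =>
    simp only [Finset.prod_insert ha]
    exact (hf a (Finset.mem_insert_self a s)).mul
      (ih fun i hi => hf i (Finset.mem_insert_of_mem hi))

theorem isAlgebraic_adjoinRoot {R : Type*} [CommRing R] [IsDomain R] {p : Polynomial R}
    (hp : p ≠ 0) : Algebra.IsAlgebraic R (AdjoinRoot p) := by
  have h := (Algebra.isAlgebraic_adjoin_singleton_iff (R := R) (s := AdjoinRoot.root p)).2
    (AdjoinRoot.isAlgebraic_root hp)
  rw [AdjoinRoot.adjoinRoot_eq_top] at h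
  exact ⟨fun x => h x trivial⟩

/-- A function which is algebraic over a function algebraic over the polynomials is algebraic. -/
theorem AlgOn.of_primitive_relation {U : Set (Fin n → ℂ)} {y f : (Fin n → ℂ) → ℂ}
    {P : Polynomial (MvPolynomial (Fin n) ℂ)} (hP : P ≠ 0)
    (hPy : ∀ x ∈ U, Polynomial.eval₂ (MvPolynomial.eval x) (y x) P = 0)
    {Q : Polynomial (Polynomial (MvPolynomial (Fin n) ℂ))} (hQ : Q.IsPrimitive)
    (hQf : ∀ x ∈ U,
      Polynomial.eval₂ (Polynomial.eval₂RingHom (MvPolynomial.eval x) (y x)) (f x) Q = 0) :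
    AlgOn U f := by
  induction P using UniqueFactorizationMonoid.induction_on_prime generalizing U with
  | h₁ => exact absurd rfl hP
  | h₂ P hunit =>
    refine ⟨1, one_ne_zero, fun x hx => absurd (hPy x hx) ?_⟩
    exact (hunit.map (Polynomial.eval₂RingHom (MvPolynomial.eval x) (y x))).ne_zero
  | h₃ P p hP₀ hp ih =>
    have hU : U = {x ∈ U | Polynomial.eval₂ (MvPolynomial.eval x) (y x) P = 0} ∪
        {x ∈ U | Polynomial.eval₂ (MvPolynomial.eval x) (y x) p = 0} := by
      ext x
      simp only [mem_union, mem_ofPred_eq, ← and_or_left]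
      refine ⟨fun hx => ⟨hx, ?_⟩, fun hx => hx.1⟩
      have := hPy x hx
      rw [Polynomial.eval₂_mul, mul_eq_zero] at this
      exact this.symm
    rw [hU]
    refine AlgOn.union (ih hP₀ (fun x hx => hx.2) fun x hx => hQf x hx.1) ?_
    set U' := {x ∈ U | Polynomial.eval₂ (MvPolynomial.eval x) (y x) p = 0} with hU'
    rw [algOn_iff_isAlgebraic]
    have : IsDomain (AdjoinRoot p) := AdjoinRoot.isDomain_of_prime hp
    have halg := isAlgebraic_adjoinRoot hp.ne_zero
    let _ := (evalOn U').toAlgebra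
    have hpy : Polynomial.eval₂ (evalOn U') (fun x => y x) p = 0 := by
      funext x
      rw [eval₂_evalOn_apply]
      exact x.2.2
    let φ : AdjoinRoot p →+* (U' → ℂ) := AdjoinRoot.lift (evalOn U') (fun x => y x) hpy
    let _ := φ.toAlgebra
    have : IsScalarTower (MvPolynomial (Fin n) ℂ) (AdjoinRoot p) (U' → ℂ) :=
      IsScalarTower.of_algebraMap_eq fun r => (AdjoinRoot.lift_of hpy).symm
    refine IsAlgebraic.restrictScalars (MvPolynomial (Fin n) ℂ) (S := AdjoinRoot p)
      ⟨Q.map (AdjoinRoot.mk p), ?_, ?_⟩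
    · intro h0
      refine hp.not_isUnit (hQ p ?_)
      rw [Polynomial.C_dvd_iff_dvd_coeff]
      intro i
      rw [← AdjoinRoot.mk_eq_zero, ← Polynomial.coeff_map, h0, Polynomial.coeff_zero]
    · funext x
      rw [Polynomial.aeval_def, Polynomial.eval₂_map]
      change Pi.evalRingHom (fun _ => ℂ) x (Polynomial.eval₂ _ _ Q) = 0
      rw [Polynomial.hom_eval₂, ← hQf x x.2.1]
      congr 1
      refine Polynomial.ringHom_ext (fun a => ?_) ?_
      · change φ (AdjoinRoot.of p a) x = _
        rw [AdjoinRoot.lift_of]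
        rw [Polynomial.coe_eval₂RingHom, Polynomial.eval₂_C]
        rfl
      · change φ (AdjoinRoot.root p) x = _
        rw [AdjoinRoot.lift_root]
        simp

end Algebraicity

section NashRelations

open Metric Set

variable {n : ℕ}

/-- Separate the last coordinate. -/
noncomputable def splitLast (n : ℕ) : (Fin (n + 1) → ℂ) ≃L[ℂ] (Fin n → ℂ) × ℂ :=
  LinearEquiv.toContinuousLinearEquiv
    { toFun := fun x => (fun i => x i.castSucc, x (Fin.last n))
      invFun := fun p => Fin.snoc p.1 p.2
      map_add' := fun _ _ => rfl
      map_smul' := fun _ _ => rfl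
      left_inv := fun x => Fin.snoc_init_self x
      right_inv := fun p => by ext <;> simp }

theorem splitLast_symm_apply (p : (Fin n → ℂ) × ℂ) :
    (splitLast n).symm p = Fin.snoc (α := fun _ => ℂ) p.1 p.2 := rfl

/-- The function `F` satisfies the polynomial relation `Q` on `W`. -/
def PolyRel (W : Set ((Fin n → ℂ) × ℂ)) (F : (Fin n → ℂ) × ℂ → ℂ)
    (Q : Polynomial (Polynomial (MvPolynomial (Fin n) ℂ))) : Prop :=
  ∀ p ∈ W, Polynomial.eval₂ (Polynomial.eval₂RingHom (MvPolynomial.eval p.1) p.2) (F p) Q = 0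

theorem continuous_eval₂_eval (P : Polynomial (MvPolynomial (Fin n) ℂ)) :
    Continuous fun p : (Fin n → ℂ) × ℂ => Polynomial.eval₂ (MvPolynomial.eval p.1) p.2 P := by
  simp only [Polynomial.eval₂_eq_sum_range]
  refine continuous_finsetSum _ fun i _ => ?_
  exact ((MvPolynomial.continuous_eval _).comp continuous_fst).mul (continuous_snd.pow i)

theorem continuousOn_eval₂_eval₂ {W : Set ((Fin n → ℂ) × ℂ)} {F : (Fin n → ℂ) × ℂ → ℂ}
    (hF : ContinuousOn F W) (Q : Polynomial (Polynomial (MvPolynomial (Fin n) ℂ))) :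
    ContinuousOn (fun p =>
      Polynomial.eval₂ (Polynomial.eval₂RingHom (MvPolynomial.eval p.1) p.2) (F p) Q) W := by
  simp only [Polynomial.eval₂_eq_sum_range]
  refine continuousOn_finsetSum _ fun i _ => ?_
  exact (continuous_eval₂_eval _).continuousOn.mul (hF.pow i)

theorem PolyRel.of_mul {W : Set ((Fin n → ℂ) × ℂ)} (hW : IsOpen W)
    {F : (Fin n → ℂ) × ℂ → ℂ} (hF : ContinuousOn F W)
    {Q : Polynomial (Polynomial (MvPolynomial (Fin n) ℂ))} {c : (Fin n → ℂ) × ℂ → ℂ}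
    (hc : ∀ W' ⊆ W, IsOpen W' → W'.Nonempty → ∃ p ∈ W', c p ≠ 0)
    (h : ∀ p ∈ W, c p *
      Polynomial.eval₂ (Polynomial.eval₂RingHom (MvPolynomial.eval p.1) p.2) (F p) Q = 0) :
    PolyRel W F Q := by
  intro p hp
  by_contra hne
  obtain ⟨p', hp', hcp'⟩ := hc _ inter_subset_left
    ((continuousOn_eval₂_eval₂ hF Q).isOpen_inter_preimage hW isOpen_ne) ⟨p, hp, hne⟩
  exact hp'.2 ((mul_eq_zero.1 (h p' hp'.1)).resolve_left hcp')

theorem exists_eval_ne_zero {P : Polynomial (MvPolynomial (Fin n) ℂ)} (hP : P ≠ 0)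
    {W : Set ((Fin n → ℂ) × ℂ)} (hW : IsOpen W) (hne : W.Nonempty) :
    ∃ p ∈ W, Polynomial.eval₂ (MvPolynomial.eval p.1) p.2 P ≠ 0 := by
  obtain ⟨⟨a, b⟩, hab⟩ := hne
  obtain ⟨A, hA, B, hB, hAB⟩ := mem_nhds_prod_iff.1 (hW.mem_nhds hab)
  obtain ⟨ε, hε, hεA⟩ := Metric.mem_nhds_iff.1 hA
  obtain ⟨j, hj⟩ : ∃ j, P.coeff j ≠ 0 := by
    by_contra! h
    exact hP (Polynomial.ext h)
  obtain ⟨x, hxA, hx⟩ : ∃ x ∈ A, MvPolynomial.eval x (P.coeff j) ≠ 0 := by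
    by_contra! h
    refine hj (MvPolynomial.funext_set (fun i => ball (a i) ε)
      (fun i => infinite_of_mem_nhds (a i) (ball_mem_nhds _ hε)) fun x hx => ?_)
    rw [map_zero]
    refine h x (hεA ?_)
    rw [ball_pi a hε]
    exact hx
  have hPx : P.map (MvPolynomial.eval x) ≠ 0 := by
    intro h0
    rw [← Polynomial.coeff_map, h0] at hx
    exact hx rfl
  obtain ⟨y, hyB, hy⟩ : ∃ y ∈ B, (P.map (MvPolynomial.eval x)).eval y ≠ 0 := by
    by_contra! h
    refine infinite_of_mem_nhds b hB ((P.map (MvPolynomial.eval x)).roots.toFinset.finite_toSet.subset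
      fun y hy => ?_)
    simpa [hPx] using h y hy
  exact ⟨(x, y), hAB ⟨hxA, hyB⟩, by rwa [Polynomial.eval_map] at hy⟩

/-- Polynomials in `n + 1` variables as polynomials in the last variable. -/
noncomputable def lastVarEquiv (n : ℕ) :
    MvPolynomial (Fin (n + 1)) ℂ ≃+* Polynomial (MvPolynomial (Fin n) ℂ) :=
  ((MvPolynomial.renameEquiv ℂ (finRotate (n + 1))).trans (MvPolynomial.finSuccEquiv ℂ n)).toRingEquiv

theorem eval₂_lastVarEquiv (p : (Fin n → ℂ) × ℂ) (P : MvPolynomial (Fin (n + 1)) ℂ) :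
    Polynomial.eval₂ (MvPolynomial.eval p.1) p.2 (lastVarEquiv n P) =
      MvPolynomial.eval ((splitLast n).symm p) P := by
  rw [splitLast_symm_apply, Fin.snoc_eq_cons_rotate]
  change Polynomial.eval₂ _ _ (MvPolynomial.finSuccEquiv ℂ n
    (MvPolynomial.rename (finRotate (n + 1)) P)) = _
  rw [← Polynomial.eval_map, ← MvPolynomial.eval_eq_eval_mv_eval', MvPolynomial.eval_rename]
  rfl

theorem NashFn.exists_polyRel {W : Set (Fin (n + 1) → ℂ)} (hW : IsOpen W)
    {f : (Fin (n + 1) → ℂ) → ℂ} (hf : NashFn (n + 1) W f) {p : (Fin n → ℂ) × ℂ}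
    (hp : (splitLast n).symm p ∈ W) :
    ∃ V : Set ((Fin n → ℂ) × ℂ), IsOpen V ∧ p ∈ V ∧
      ∃ Q : Polynomial (Polynomial (MvPolynomial (Fin n) ℂ)), Q.IsPrimitive ∧
        PolyRel V (fun p => f ((splitLast n).symm p)) Q := by
  obtain ⟨hfd, hfP⟩ := hf
  obtain ⟨V, hV, hpV, P, hP, hPf⟩ := hfP _ hp
  obtain ⟨_⟩ : Nonempty (NormalizedGCDMonoid (Polynomial (MvPolynomial (Fin n) ℂ))) := by
    classical
    let _ := UniqueFactorizationMonoid.strongNormalizationMonoid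
      (α := Polynomial (MvPolynomial (Fin n) ℂ))
    exact ⟨UniqueFactorizationMonoid.toNormalizedGCDMonoid _⟩
  set Q := P.map (lastVarEquiv n : _ →+* Polynomial (MvPolynomial (Fin n) ℂ)) with hQ
  have hQ0 : Q ≠ 0 := (Polynomial.map_ne_zero_iff (lastVarEquiv n).injective).2 hP
  have hcont : Continuous (splitLast n).symm := (splitLast n).symm.continuous
  refine ⟨(splitLast n).symm ⁻¹' (V ∩ W), (hV.inter hW).preimage hcont, ⟨hpV, hp⟩, Q.primPart,
    Q.isPrimitive_primPart, ?_⟩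
  refine PolyRel.of_mul ((hV.inter hW).preimage hcont)
    (c := fun p => Polynomial.eval₂ (MvPolynomial.eval p.1) p.2 Q.content)
    (hfd.continuousOn.comp hcont.continuousOn fun p hp => hp.2)
    (fun W' _ hW' hne => exists_eval_ne_zero (by rwa [Ne, Polynomial.content_eq_zero_iff]) hW' hne)
    fun p hp => ?_
  have h1 := hPf _ hp
  have h2 : Polynomial.eval₂ (Polynomial.eval₂RingHom (MvPolynomial.eval p.1) p.2)
      (f ((splitLast n).symm p)) Q = 0 := by
    rw [hQ, Polynomial.eval₂_map, ← h1]
    congr 1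
    refine RingHom.ext fun a => ?_
    exact eval₂_lastVarEquiv p a
  rw [Q.eq_C_content_mul_primPart, Polynomial.eval₂_mul, Polynomial.eval₂_C] at h2
  exact h2

variable {h : (Fin n → ℂ) × ℂ → ℂ} {O : Set ((Fin n → ℂ) × ℂ)} {U : Set (Fin n → ℂ)} {c : ℂ}
  {r : ℝ}

theorem IsChart.exists_ne_zero (H : IsChart h O U c r) {W : Set ((Fin n → ℂ) × ℂ)}
    (hW : IsOpen W) (hne : W.Nonempty) (hWU : W ⊆ U ×ˢ ball c r) : ∃ p ∈ W, h p ≠ 0 := by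
  obtain ⟨⟨x, w⟩, hxw⟩ := hne
  by_contra! h0
  have hx : x ∈ U := (hWU hxw).1
  have hfin := finite_zeros_closedBall H.radius_pos.le (isOpen_fibre H.isOpen_source x) (H.closedBall_subset hx)
    (H.differentiableOn_fibre H.differentiableOn x) (H.ne_zero x hx)
  refine infinite_of_mem_nhds w ?_ hfin
  filter_upwards [(isOpen_fibre hW x).mem_nhds hxw] with z hz
  exact ⟨ball_subset_closedBall (hWU hz).2, h0 _ hz⟩

theorem IsChart.algOn_of_polyRel (H : IsChart h O U c r)
    {Qh : Polynomial (Polynomial (MvPolynomial (Fin n) ℂ))} (hQh : Qh ≠ 0)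
    (hrel : PolyRel (U ×ˢ ball c r) h Qh) {y : (Fin n → ℂ) → ℂ} (hyb : ∀ x ∈ U, y x ∈ ball c r)
    (hy : ∀ x ∈ U, h (x, y x) = 0) {F : (Fin n → ℂ) × ℂ → ℂ}
    {Q : Polynomial (Polynomial (MvPolynomial (Fin n) ℂ))} (hQ : Q.IsPrimitive)
    (hF : PolyRel (U ×ˢ ball c r) F Q) : AlgOn U fun x => F (x, y x) := by
  obtain ⟨Q₁, hQ₁, hX⟩ := Polynomial.exists_eq_pow_rootMultiplicity_mul_and_not_dvd Qh hQh 0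
  rw [map_zero, sub_zero, Polynomial.X_dvd_iff] at hX
  rw [map_zero, sub_zero] at hQ₁
  have hrel₁ : PolyRel (U ×ˢ ball c r) h Q₁ := by
    refine PolyRel.of_mul (c := fun p => h p ^ Qh.rootMultiplicity 0)
      (H.isOpen_base.prod isOpen_ball) (H.differentiableOn.continuousOn.mono
        ((prod_mono_right ball_subset_closedBall).trans H.subset)) (fun W' hW' hW'o hne => ?_)
        fun p hp => ?_
    · obtain ⟨p, hp, hp0⟩ := H.exists_ne_zero hW'o hne hW'
      exact ⟨p, hp, pow_ne_zero _ hp0⟩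
    · have := hrel p hp
      rwa [hQ₁, Polynomial.eval₂_mul, Polynomial.eval₂_pow, Polynomial.eval₂_X] at this
  refine AlgOn.of_primitive_relation hX (fun x hx => ?_) hQ fun x hx => hF (x, y x) ⟨hx, hyb x hx⟩
  have := hrel₁ (x, y x) ⟨hx, hyb x hx⟩
  rwa [hy x hx, Polynomial.eval₂_at_zero] at this

end NashRelations

section LocalProjection

open Metric Set

theorem exists_isChart {E : Type*} [NormedAddCommGroup E] [NormedSpace ℂ E]
    {h : E × ℂ → ℂ} {O : Set (E × ℂ)} (hO : IsOpen O)
    (hh : DifferentiableOn ℂ h O) {a : E} {b : ℂ} (hab : (a, b) ∈ O)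
    (hne : ¬∀ᶠ w in 𝓝 b, h (a, w) = 0) {ε : ℝ} (hε : 0 < ε) :
    ∃ r < ε, ∃ δ > 0, IsChart h O (ball a δ) b r := by
  have hfd : DifferentiableOn ℂ (fun w => h (a, w)) {w | (a, w) ∈ O} :=
    hh.comp (by fun_prop) fun _ hw => hw
  have han : AnalyticAt ℂ (fun w => h (a, w)) b :=
    hfd.analyticAt ((isOpen_fibre hO a).mem_nhds hab)
  have h1 := (han.eventually_eq_zero_or_eventually_ne_zero).resolve_left hne
  rw [eventually_nhdsWithin_iff] at h1
  obtain ⟨ρ, hρ, hρh⟩ := Metric.eventually_nhds_iff_ball.1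
    (h1.and ((isOpen_fibre hO a).eventually_mem hab))
  set r := min ρ ε / 2 with hr
  have hrpos : 0 < r := half_pos (lt_min hρ hε)
  have hrε : r < ε := (half_lt_self (lt_min hρ hε)).trans_le (min_le_right _ _)
  have hrρ : r < ρ := (half_lt_self (lt_min hρ hε)).trans_le (min_le_left _ _)
  have hO' : IsOpen (O ∩ {p | h p ≠ 0}) := hh.continuousOn.isOpen_inter_preimage hO isOpen_ne
  obtain ⟨u, v, hu, -, hau, hbu, huO⟩ := generalized_tube_lemma (isCompact_singleton (x := a))
    (isCompact_closedBall b r) hO (by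
      rintro ⟨x, w⟩ ⟨rfl, hw⟩
      exact (hρh w (closedBall_subset_ball hrρ hw)).2)
  obtain ⟨u', v', hu', -, hau', hbu', huO'⟩ := generalized_tube_lemma
    (isCompact_singleton (x := a)) (isCompact_sphere b r) hO' (by
      rintro ⟨x, w⟩ ⟨rfl, hw⟩
      have := hρh w (closedBall_subset_ball hrρ (sphere_subset_closedBall hw))
      exact ⟨this.2, this.1 (ne_of_mem_sphere hw hrpos.ne')⟩)
  obtain ⟨δ, hδ, hδu⟩ := Metric.isOpen_iff.1 (hu.inter hu') a ⟨hau rfl, hau' rfl⟩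
  exact ⟨r, hrε, δ, hδ, hO, isOpen_ball, hrpos,
    fun p hp => huO ⟨(hδu hp.1).1, hbu hp.2⟩, hh,
    fun x hx y hy => (huO' (⟨(hδu hx).2, hbu' hy⟩ : (x, y) ∈ u' ×ˢ _)).2⟩

variable {n q : ℕ} {O : Set ((Fin n → ℂ) × ℂ)} {U : Set (Fin n → ℂ)} {c : ℂ} {r : ℝ}
  {g : Fin q → (Fin n → ℂ) × ℂ → ℂ}

theorem IsChart.exists_nash_projection {i₀ : Fin q} (H : IsChart (g i₀) O U c r)
    (hU : IsPreconnected U) (hg : ∀ i, DifferentiableOn ℂ (g i) O)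
    (hQ : ∀ i, ∃ Q, Q.IsPrimitive ∧ PolyRel O (g i) Q) :
    ∃ (M : ℕ) (N : Fin M → (Fin n → ℂ) → ℂ), (∀ s, NashFn n U (N s)) ∧
      {x ∈ U | ∃ w ∈ ball c r, ∀ i, g i (x, w) = 0} = {x ∈ U | ∀ s, N s x = 0} := by
  obtain ⟨m, y, hyb, hy0, hyd, hyX⟩ := H.exists_projection_equations hU hg fun p _ hp => hp i₀
  have hsub : U ×ˢ ball c r ⊆ O := (prod_mono_right ball_subset_closedBall).trans H.subset
  choose Q hQp hQr using hQ
  refine ⟨m * q + 1, fun s x => ∏ l, ∑ i : Fin q, ((s : ℕ) : ℂ) ^ (i : ℕ) * g i (x, y x l),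
    fun s => ⟨hyd _, fun x₀ hx₀ => ?_⟩, ?_⟩
  · have hA : AlgOn U fun x => ∏ l, ∑ i : Fin q, ((s : ℕ) : ℂ) ^ (i : ℕ) * g i (x, y x l) :=
      AlgOn.prod fun l _ => AlgOn.sum fun i _ => (algOn_const U _).mul
        (H.algOn_of_polyRel (hQp i₀).ne_zero (fun p hp => hQr i₀ p (hsub hp))
          (fun x hx => hyb x hx l) (fun x hx => hy0 x hx l) (hQp i)
          fun p hp => hQr i p (hsub hp))
    obtain ⟨P, hP, hPx⟩ := hA
    exact ⟨U, H.isOpen_base, hx₀, P, hP, fun x hx => hPx x hx.1⟩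
  · ext x
    exact and_congr_right fun hx => hyX x hx

theorem IsChart.exists_holomorphic_projection {E : Type*} [NormedAddCommGroup E] [NormedSpace ℂ E]
    [FiniteDimensional ℂ E] {O : Set (E × ℂ)} {U : Set E} {g : Fin q → E × ℂ → ℂ} {i₀ : Fin q}
    (H : IsChart (g i₀) O U c r)
    (hU : IsPreconnected U) (hg : ∀ i, DifferentiableOn ℂ (g i) O) :
    ∃ (M : ℕ) (N : Fin M → E → ℂ), (∀ s, DifferentiableOn ℂ (N s) U) ∧
      {x ∈ U | ∃ w ∈ ball c r, ∀ i, g i (x, w) = 0} = {x ∈ U | ∀ s, N s x = 0} := by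
  obtain ⟨m, y, -, -, hyd, hyX⟩ := H.exists_projection_equations hU hg fun p _ hp => hp i₀
  refine ⟨m * q + 1, fun s x => ∏ l, ∑ i : Fin q, ((s : ℕ) : ℂ) ^ (i : ℕ) * g i (x, y x l),
    fun s => hyd _, ?_⟩
  ext x
  exact and_congr_right fun hx => hyX x hx

end LocalProjection

section Graph

open Metric Set

theorem exists_open_subset_of_finset_cover {X ι : Type*} [TopologicalSpace X] (T : Finset ι)
    (C : ι → Set X) {D : Set X} (hD : IsOpen D) (hne : D.Nonempty)
    (hC : ∀ t ∈ T, IsOpen (D \ C t)) (hcov : ∀ z ∈ D, ∃ t ∈ T, z ∈ C t) :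
    ∃ t ∈ T, ∃ D' ⊆ D, IsOpen D' ∧ D'.Nonempty ∧ D' ⊆ C t := by
  classical
  induction T using Finset.induction_on generalizing D with
  | empty =>
    obtain ⟨z, hz⟩ := hne
    obtain ⟨t, ht, -⟩ := hcov z hz
    simp at ht
  | insert a T haT ih =>
    rcases (D \ C a).eq_empty_or_nonempty with h | h
    · exact ⟨a, Finset.mem_insert_self a T, D, Subset.rfl, hD, hne, sdiff_eq_empty.1 h⟩
    · obtain ⟨t, ht, D', hD', h'⟩ := ih (hC a (Finset.mem_insert_self a T)) h (fun t ht => by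
        have : (D \ C a) \ C t = (D \ C a) ∩ (D \ C t) := by
          ext z
          simp only [Set.mem_sdiff, mem_inter_iff]
          tauto
        rw [this]
        exact (hC a (Finset.mem_insert_self a T)).inter (hC t (Finset.mem_insert_of_mem ht)))
        (fun z hz => by
          obtain ⟨t, ht, hzt⟩ := hcov z hz.1
          rcases Finset.mem_insert.1 ht with rfl | ht
          · exact absurd hzt hz.2
          · exact ⟨t, ht, hzt⟩)
      exact ⟨t, Finset.mem_insert_of_mem ht, D', hD'.trans sdiff_subset, h'⟩

theorem isOpen_diff_projection {E : Type*} [TopologicalSpace E] {O Z : Set (E × ℂ)}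
    (hZ : ∀ p ∈ O, p ∈ closure Z → p ∈ Z) {D : Set E} (hD : IsOpen D)
    {K : Set ℂ} (hK : IsCompact K) (hDK : D ×ˢ K ⊆ O) :
    IsOpen (D \ {z | ∃ w ∈ K, (z, w) ∈ Z}) := by
  rw [isOpen_iff_mem_nhds]
  rintro z ⟨hzD, hz⟩
  obtain ⟨u, v, hu, -, hzu, hKv, huv⟩ := generalized_tube_lemma (isCompact_singleton (x := z)) hK
    (isOpen_compl_iff.2 (isClosed_closure (s := Z))) (by
      rintro ⟨x, w⟩ ⟨rfl, hw⟩ hcl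
      exact hz ⟨w, hw, hZ _ (hDK ⟨hzD, hw⟩) hcl⟩)
  filter_upwards [hu.mem_nhds (hzu rfl), hD.mem_nhds hzD] with x hxu hxD
  refine ⟨hxD, ?_⟩
  rintro ⟨w, hw, hxw⟩
  exact huv (⟨hxu, hKv hw⟩ : (x, w) ∈ u ×ˢ v) (subset_closure hxw)

variable {E : Type*} [NormedAddCommGroup E] [NormedSpace ℂ E]
  {h : E × ℂ → ℂ} {O Z : Set (E × ℂ)}

theorem exists_separating_radius (T : Finset ℂ) {c : ℂ} {r : ℝ} (hT : ∀ t ∈ T, t ∈ ball c r) :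
    ∃ ρ > 0, ∀ t ∈ T, closedBall t ρ ⊆ ball c r ∧ ∀ t' ∈ T, t' ≠ t → 2 * ρ < dist t' t := by
  have h : ∀ᶠ ρ in 𝓝[>] (0 : ℝ), ∀ t ∈ T, closedBall t ρ ⊆ ball c r ∧
      ∀ t' ∈ T, t' ≠ t → 2 * ρ < dist t' t := by
    rw [Finset.eventually_all]
    intro t ht
    refine Eventually.and ?_ ?_
    · have h0 : (0 : ℝ) < r - dist t c := sub_pos.2 (hT t ht)
      filter_upwards [nhdsWithin_le_nhds (Iio_mem_nhds h0)] with ρ hρ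
      exact closedBall_subset_ball' (by have := mem_Iio.1 hρ; linarith)
    · rw [Finset.eventually_all]
      intro t' _
      by_cases htt : t' = t
      · simp [htt]
      · have h0 : (0 : ℝ) < dist t' t / 2 := half_pos (dist_pos.2 htt)
        filter_upwards [nhdsWithin_le_nhds (Iio_mem_nhds h0)] with ρ hρ _
        have := mem_Iio.1 hρ
        linarith
  obtain ⟨ρ, hρ, hρ0⟩ := (h.and self_mem_nhdsWithin).exists
  exact ⟨ρ, hρ0, hρ⟩

/-- Over a suitable open subset of the base, a set contained in the zero set of `h` and meeting
all fibres contains an isolated holomorphic graph. -/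
theorem IsChart.exists_graph [FiniteDimensional ℂ E] {D : Set E} {c : ℂ} {r : ℝ}
    (H : IsChart h O D c r) (hne : D.Nonempty) (hZ : ∀ p ∈ O, p ∈ closure Z → p ∈ Z)
    (hZh : ∀ p ∈ O, p ∈ Z → h p = 0) (hex : ∀ z ∈ D, ∃ w ∈ ball c r, (z, w) ∈ Z) :
    ∃ D' ⊆ D, IsOpen D' ∧ D'.Nonempty ∧ ∃ (c' : ℂ) (r' : ℝ), ball c' r' ⊆ ball c r ∧
      ∃ η : E → ℂ, DifferentiableOn ℂ η D' ∧ ∀ z ∈ D', η z ∈ ball c' r' ∧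
        ∀ w ∈ ball c' r', (z, w) ∈ Z ↔ w = η z := by
  classical
  have key : ∀ (m : ℕ) (D : Set E) (c : ℂ) (r : ℝ), IsChart h O D c r → D.Nonempty →
      (∀ z ∈ D, ∃ w ∈ ball c r, (z, w) ∈ Z) → ∀ s : E → Multiset ℂ,
      (∀ x ∈ D, IsZeroMultiset (fun y => h (x, y)) c r (s x)) → (∀ x ∈ D, (s x).card = m) →
      ∃ D' ⊆ D, IsOpen D' ∧ D'.Nonempty ∧ ∃ (c' : ℂ) (r' : ℝ), ball c' r' ⊆ ball c r ∧
        ∃ η : E → ℂ, DifferentiableOn ℂ η D' ∧ ∀ z ∈ D', η z ∈ ball c' r' ∧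
          ∀ w ∈ ball c' r', (z, w) ∈ Z ↔ w = η z := by
    intro m
    induction m using Nat.strong_induction_on with
    | _ m ih =>
    intro D c r H hne hex s hs hm
    have hmem : ∀ z ∈ D, ∀ w ∈ ball c r, (z, w) ∈ Z → w ∈ s z := fun z hz w hw hzw =>
      ((hs z hz).mem_iff (ball_subset_closedBall hw)).2
        (hZh _ (H.subset ⟨hz, ball_subset_closedBall hw⟩) hzw)
    by_cases hall : ∀ z ∈ D, ∀ w ∈ s z, ∀ w' ∈ s z, w = w'
    · refine ⟨D, Subset.rfl, H.isOpen_base, hne, c, r, Subset.rfl,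
        fun z => (m : ℂ)⁻¹ * ((s z).map fun y => y).sum,
        (H.differentiableOn_sum hs (F := Prod.snd) (by fun_prop)).const_mul _, fun z hz => ?_⟩
      obtain ⟨w₀, hw₀, hzw₀⟩ := hex z hz
      have hw₀s := hmem z hz w₀ hw₀ hzw₀
      have hrep : s z = Multiset.replicate m w₀ :=
        Multiset.eq_replicate.2 ⟨hm z hz, fun w hw => hall z hz w hw w₀ hw₀s⟩
      have hm0 : (m : ℂ) ≠ 0 := by
        rintro h0
        rw [Nat.cast_eq_zero.1 h0] at hrep
        simp [hrep] at hw₀s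
      have hη : (m : ℂ)⁻¹ * ((s z).map fun y => y).sum = w₀ := by
        rw [hrep]
        simp [hm0]
      simp only [hη]
      refine ⟨hw₀, fun w hw => ⟨fun hzw => hall z hz w (hmem z hz w hw hzw) w₀ hw₀s, ?_⟩⟩
      rintro rfl
      exact hzw₀
    · push Not at hall
      obtain ⟨z₀, hz₀, w₁, hw₁, w₂, hw₂, hw₁₂⟩ := hall
      set T := (s z₀).toFinset with hT
      obtain ⟨ρ, hρ, hρT⟩ := exists_separating_radius T (c := c) (r := r)
        fun t ht => (hs z₀ hz₀).1 t (Multiset.mem_toFinset.1 ht)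
      set K : Set ℂ := closedBall c r ∩ {y | ∀ t ∈ T, ρ ≤ dist y t} with hK
      have hKc : IsCompact K := by
        refine (isCompact_closedBall c r).inter_right ?_
        simp only [ofPred_forall]
        exact isClosed_biInter fun t _ => isClosed_le continuous_const (by fun_prop)
      have hO' : IsOpen (O ∩ {p | h p ≠ 0}) :=
        H.differentiableOn.continuousOn.isOpen_inter_preimage H.isOpen_source isOpen_ne
      obtain ⟨u, v, hu, -, hzu, hKv, huv⟩ := generalized_tube_lemma
        (isCompact_singleton (x := z₀)) hKc hO' (by
          rintro ⟨x, w⟩ ⟨rfl, hw⟩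
          refine ⟨H.subset ⟨hz₀, hw.1⟩, fun h0 => ?_⟩
          have hws : w ∈ T := Multiset.mem_toFinset.2 (((hs x hz₀).mem_iff hw.1).2 h0)
          have := hw.2 w hws
          rw [dist_self] at this
          exact absurd this (not_le.2 hρ))
      obtain ⟨δ, hδ, hδu⟩ := Metric.isOpen_iff.1 (hu.inter H.isOpen_base) z₀ ⟨hzu rfl, hz₀⟩
      have hK0 : ∀ z ∈ ball z₀ δ, ∀ y ∈ K, h (z, y) ≠ 0 := fun z hz y hy =>
        (huv (⟨(hδu hz).1, hKv hy⟩ : (z, y) ∈ u ×ˢ v)).2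
      have hsph : ∀ t ∈ T, sphere t ρ ⊆ K := by
        refine fun t ht y hy => ⟨ball_subset_closedBall ((hρT t ht).1
          (sphere_subset_closedBall hy)), fun t' ht' => ?_⟩
        by_cases htt : t' = t
        · rw [htt, mem_sphere.1 hy]
        · have h1 := (hρT t ht).2 t' ht' htt
          have h2 := dist_triangle_left t' t y
          rw [mem_sphere.1 hy] at h2
          linarith
      have hδD : ball z₀ δ ⊆ D := fun z hz => (hδu hz).2
      have hcb : ∀ t ∈ T, closedBall t ρ ⊆ closedBall c r := fun t ht =>
        (hρT t ht).1.trans ball_subset_closedBall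
      have Ht : ∀ t ∈ T, IsChart h O (ball z₀ δ) t ρ := fun t ht =>
        ⟨H.isOpen_source, isOpen_ball, hρ, (prod_mono hδD (hcb t ht)).trans H.subset,
          H.differentiableOn, fun z hz y hy => hK0 z hz y (hsph t ht hy)⟩
      obtain ⟨t, ht, D', hD', hD'o, hD'ne, hD't⟩ := exists_open_subset_of_finset_cover T
        (fun t => {z | ∃ w ∈ closedBall t ρ, (z, w) ∈ Z}) (isOpen_ball (x := z₀) (ε := δ))
        ⟨z₀, mem_ball_self hδ⟩
        (fun t ht => isOpen_diff_projection hZ isOpen_ball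
          (isCompact_closedBall t ρ) (Ht t ht).subset)
        (fun z hz => by
          obtain ⟨w, hw, hzw⟩ := hex z (hδD hz)
          by_contra! hcon
          refine hK0 z hz w ⟨ball_subset_closedBall hw, fun t ht => ?_⟩
            (hZh _ (H.subset ⟨hδD hz, ball_subset_closedBall hw⟩) hzw)
          by_contra hlt
          exact hcon t ht ⟨w, mem_closedBall.2 (not_le.1 hlt).le, hzw⟩)
      set s' : E → Multiset ℂ := fun x => (s x).filter (· ∈ ball t ρ) with hs'
      have hs'z : ∀ x ∈ ball z₀ δ, IsZeroMultiset (fun y => h (x, y)) t ρ (s' x) := fun x hx =>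
        (hs x (hδD hx)).restrict (hcb t ht) ((Ht t ht).ne_zero x hx)
      obtain ⟨m', hm'⟩ := (Ht t ht).exists_card_eq (convex_ball z₀ δ).isPreconnected hs'z
      have hlt : m' < m := by
        rw [← hm' z₀ (mem_ball_self hδ), ← hm z₀ hz₀]
        obtain ⟨w, hw, hwt⟩ : ∃ w ∈ s z₀, w ≠ t := by
          by_cases h1 : w₁ = t
          · exact ⟨w₂, hw₂, fun h2 => hw₁₂ (h1.trans h2.symm)⟩
          · exact ⟨w₁, hw₁, h1⟩
        refine Multiset.card_lt_card (lt_of_le_of_ne (Multiset.filter_le _ _) fun heq => ?_)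
        have h1 := Multiset.filter_eq_self.1 heq w hw
        have h2 := (hρT t ht).2 w (Multiset.mem_toFinset.2 hw) hwt
        have h3 := mem_ball.1 h1
        linarith
      obtain ⟨D'', hD'', hD''o, hD''ne, c', r', hcr, hη⟩ := ih m' hlt D' t ρ
        ((Ht t ht).mono hD'o hD') hD'ne (fun z hz => by
          obtain ⟨w, hw, hzw⟩ := hD't hz
          refine ⟨w, lt_of_le_of_ne (mem_closedBall.1 hw) fun hsp => ?_, hzw⟩
          exact (Ht t ht).ne_zero z (hD' hz) w hsp
            (hZh _ ((Ht t ht).subset ⟨hD' hz, hw⟩) hzw)) s' (fun x hx => hs'z x (hD' hx))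
        fun x hx => hm' x (hD' hx)
      exact ⟨D'', hD''.trans (hD'.trans hδD), hD''o, hD''ne, c', r',
        hcr.trans (ball_subset_closedBall.trans (hρT t ht).1), hη⟩
  have hsex : ∀ x, ∃ s, x ∈ D → IsZeroMultiset (fun y => h (x, y)) c r s := fun x => by
    by_cases hx : x ∈ D
    · obtain ⟨s, hs⟩ := H.exists_isZeroMultiset hx
      exact ⟨s, fun _ => hs⟩
    · exact ⟨0, fun h => absurd h hx⟩
  choose s hs using hsex
  obtain ⟨z₀, hz₀⟩ := hne
  obtain ⟨δ, hδ, hδD⟩ := Metric.isOpen_iff.1 H.isOpen_base z₀ hz₀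
  have H' := H.mono (isOpen_ball (x := z₀) (ε := δ)) hδD
  obtain ⟨m, hm⟩ := H'.exists_card_eq (convex_ball z₀ δ).isPreconnected
    (fun x hx => hs x (hδD hx))
  obtain ⟨D', hD', hrest⟩ := key m (ball z₀ δ) c r H' ⟨z₀, mem_ball_self hδ⟩
    (fun z hz => hex z (hδD hz)) s (fun x hx => hs x (hδD hx)) hm
  exact ⟨D', hD'.trans hδD, hrest⟩

end Graph

section Lifting

open Metric Set

variable {V : Type} [NormedAddCommGroup V] [NormedSpace ℂ V]

/-- A regular point of the projection of `X` lifts to a regular point of `X`, provided that `X` is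
locally contained in finitely many charts. -/
theorem IsRegPtOfDim.exists_lift {ι : Type*} [Finite ι] {X : Set (V × ℂ)} {Y U : Set V}
    {h : ι → V × ℂ → ℂ} {O : ι → Set (V × ℂ)} {c : ι → ℂ} {r : ι → ℝ}
    (H : ∀ j, IsChart (h j) (O j) U (c j) (r j))
    (hX : ∀ j, ∀ p ∈ O j, p ∈ closure X → p ∈ X) (hXh : ∀ j, ∀ p ∈ O j, p ∈ X → h j p = 0)
    (hU : IsOpen U) (hY : ∀ x ∈ U, x ∈ Y ↔ ∃ j, ∃ w ∈ ball (c j) (r j), (x, w) ∈ X)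
    {e : ℕ} {y₀ : V} (hy₀ : y₀ ∈ Y) (hy₀U : y₀ ∈ U) (hreg : IsRegPtOfDim e Y y₀) :
    ∃ x ∈ X, IsRegPtOfDim e X x := by
  classical
  have := Fintype.ofFinite ι
  obtain ⟨U₁, hU₁, hyU₁, e', L, Ω, g, hΩ, hg, hL⟩ := hreg
  set ψ : (Fin e → ℂ) → V := fun z => L.symm (z, g z) with hψ
  have hψd : DifferentiableOn ℂ ψ Ω :=
    L.symm.differentiable.comp_differentiableOn (differentiableOn_id.prodMk hg)
  have hψY : ∀ z ∈ Ω, ψ z ∈ Y ∩ U₁ := by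
    intro z hz
    have : (z, g z) ∈ L '' (Y ∩ U₁) := by
      rw [hL]
      exact ⟨hz, rfl⟩
    obtain ⟨v, hv, hLv⟩ := this
    change L.symm (z, g z) ∈ Y ∩ U₁
    rwa [← hLv, L.symm_apply_apply]
  have hYψ : ∀ v ∈ Y ∩ U₁, (L v).1 ∈ Ω ∧ v = ψ (L v).1 := by
    intro v hv
    have : L v ∈ L '' (Y ∩ U₁) := mem_image_of_mem _ hv
    rw [hL] at this
    refine ⟨this.1, ?_⟩
    change v = L.symm ((L v).1, g (L v).1)
    rw [← this.2, L.symm_apply_apply]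
  set D₀ := Ω ∩ ψ ⁻¹' U with hD₀
  have hD₀o : IsOpen D₀ := hψd.continuousOn.isOpen_inter_preimage hΩ hU
  have hD₀ne : D₀.Nonempty := by
    obtain ⟨h1, h2⟩ := hYψ y₀ ⟨hy₀, hyU₁⟩
    refine ⟨_, h1, ?_⟩
    rwa [mem_preimage, ← h2]
  set Ψ : (Fin e → ℂ) × ℂ → V × ℂ := fun p => (ψ p.1, p.2) with hΨ
  have hΨd : DifferentiableOn ℂ Ψ (D₀ ×ˢ univ) :=
    ((hψd.mono inter_subset_left).comp differentiableOn_fst fun p hp => hp.1).prodMk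
      differentiableOn_snd
  have hDo : IsOpen (D₀ ×ˢ (univ : Set ℂ)) := hD₀o.prod isOpen_univ
  set Z : Set ((Fin e → ℂ) × ℂ) := D₀ ×ˢ univ ∩ Ψ ⁻¹' X with hZdef
  set Ot : ι → Set ((Fin e → ℂ) × ℂ) := fun j => D₀ ×ˢ univ ∩ Ψ ⁻¹' (O j) with hOt
  have hZ : ∀ j, ∀ p ∈ Ot j, p ∈ closure Z → p ∈ Z := by
    intro j p hp hpZ
    refine ⟨hp.1, hX j _ hp.2 ?_⟩
    exact closure_mono (image_subset_iff.2 inter_subset_right)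
      ((hΨd.continuousOn.continuousAt (hDo.mem_nhds hp.1)).continuousWithinAt.mem_closure_image hpZ)
  have Hψ : ∀ j, IsChart (h j ∘ Ψ) (Ot j) D₀ (c j) (r j) := fun j =>
    ⟨hΨd.continuousOn.isOpen_inter_preimage hDo (H j).isOpen_source, hD₀o, (H j).radius_pos,
      fun p hp => ⟨⟨hp.1, mem_univ _⟩, (H j).subset ⟨hp.1.2, hp.2⟩⟩,
      (H j).differentiableOn.comp (hΨd.mono inter_subset_left) fun p hp => hp.2,
      fun x hx y hy => (H j).ne_zero _ hx.2 y hy⟩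
  obtain ⟨j, -, D₁, hD₁, hD₁o, hD₁ne, hD₁C⟩ := exists_open_subset_of_finset_cover Finset.univ
    (fun j => {z | ∃ w ∈ closedBall (c j) (r j), (z, w) ∈ Z}) hD₀o hD₀ne
    (fun j _ => isOpen_diff_projection (hZ j) hD₀o (isCompact_closedBall _ _) (Hψ j).subset)
    (fun z hz => by
      obtain ⟨j, w, hw, hzw⟩ := (hY (ψ z) hz.2).1 (hψY z hz.1).1
      exact ⟨j, Finset.mem_univ j, w, ball_subset_closedBall hw, ⟨hz, mem_univ _⟩, hzw⟩)
  obtain ⟨D', hD', hD'o, hD'ne, c', r', hcr, η, hη, hηZ⟩ :=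
    ((Hψ j).mono hD₁o hD₁).exists_graph hD₁ne (hZ j) (fun p hp hpZ => hXh j _ hp.2 hpZ.2)
      (fun z hz => by
        obtain ⟨w, hw, hzw⟩ := hD₁C hz
        refine ⟨w, lt_of_le_of_ne (mem_closedBall.1 hw) fun hsp => ?_, hzw⟩
        exact (Hψ j).ne_zero z (hD₁ hz) w hsp
          (hXh j _ ((Hψ j).subset ⟨hD₁ hz, hw⟩ : _ ∈ Ot j).2 hzw.2))
  have hD'D₀ : D' ⊆ D₀ := hD'.trans hD₁
  obtain ⟨z₀, hz₀⟩ := hD'ne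
  have hgraph : ∀ z ∈ D', (ψ z, η z) ∈ X := fun z hz =>
    (((hηZ z hz).2 _ (hηZ z hz).1).2 rfl).2
  refine ⟨(ψ z₀, η z₀), hgraph z₀ hz₀,
    {p | p.1 ∈ U ∩ U₁ ∧ (L p.1).1 ∈ D' ∧ p.2 ∈ ball c' r'}, ?_, ?_, e' + 1,
    ((L.prodCongr (ContinuousLinearEquiv.refl ℂ ℂ)).trans
      (ContinuousLinearEquiv.prodAssoc ℂ (Fin e → ℂ) (Fin e' → ℂ) ℂ)).trans
      ((ContinuousLinearEquiv.refl ℂ (Fin e → ℂ)).prodCongr (splitLast e').symm),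
    D', fun z => (splitLast e').symm (g z, η z), hD'o, ?_, ?_⟩
  · exact ((hU.inter hU₁).preimage continuous_fst).inter
      ((hD'o.preimage (by fun_prop)).inter (isOpen_ball.preimage continuous_snd))
  · refine ⟨⟨(hD'D₀ hz₀).2, (hψY z₀ (hD'D₀ hz₀).1).2⟩, ?_, (hηZ z₀ hz₀).1⟩
    simpa [hψ] using hz₀
  · exact (splitLast e').symm.differentiable.comp_differentiableOn
      ((hg.mono fun z hz => (hD'D₀ hz).1).prodMk hη)
  · ext ⟨z, t⟩
    constructor
    · rintro ⟨⟨v, w⟩, ⟨hvX, ⟨hvU, hvU₁⟩, hvD, hw⟩, heq⟩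
      have hvY : v ∈ Y := (hY v hvU).2 ⟨j, w, hcr hw, hvX⟩
      obtain ⟨-, hvψ⟩ := hYψ v ⟨hvY, hvU₁⟩
      have h1 : z = (L v).1 := (congrArg Prod.fst heq).symm
      have h2 : t = (splitLast e').symm ((L v).2, w) := (congrArg Prod.snd heq).symm
      have hwη : w = η (L v).1 := by
        refine ((hηZ _ hvD).2 w hw).1 ⟨⟨hD'D₀ hvD, mem_univ _⟩, ?_⟩
        change (ψ (L v).1, w) ∈ X
        rwa [← hvψ]
      have hgv : (L v).2 = g (L v).1 := by
        conv_lhs => rw [hvψ, hψ, L.apply_symm_apply]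
      refine ⟨by rwa [h1], ?_⟩
      simp only [h2, h1, hgv]
      rw [← hwη]
    · rintro ⟨hz, ht⟩
      simp only at hz ht
      refine ⟨(ψ z, η z), ⟨hgraph z hz, ⟨(hD'D₀ hz).2, (hψY z (hD'D₀ hz).1).2⟩, ?_,
        (hηZ z hz).1⟩, ?_⟩
      · simpa [hψ] using hz
      · rw [ht]
        simp [hψ]

end Lifting

section Discs

open Metric Set

variable {V : Type*} [NormedAddCommGroup V] [NormedSpace ℂ V]

/-- `X` contains the image of a holomorphic immersion of a nonempty open subset of `ℂ^d`. -/
def ContainsDisc (d : ℕ) (X : Set V) : Prop :=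
  ∃ D : Set (Fin d → ℂ), IsOpen D ∧ D.Nonempty ∧ ∃ φ : (Fin d → ℂ) → V, DifferentiableOn ℂ φ D ∧
    (∀ z ∈ D, Function.Injective (fderiv ℂ φ z)) ∧ ∀ z ∈ D, φ z ∈ X

theorem ContainsDisc.mono {d : ℕ} {X Y : Set V} (hX : ContainsDisc d X) (hXY : X ⊆ Y) :
    ContainsDisc d Y := by
  obtain ⟨D, hD, hne, φ, hφ, hi, hφX⟩ := hX
  exact ⟨D, hD, hne, φ, hφ, hi, fun z hz => hXY (hφX z hz)⟩

theorem ContainsDisc.nonempty {d : ℕ} {X : Set V} (hX : ContainsDisc d X) : X.Nonempty := by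
  obtain ⟨D, hD, ⟨z, hz⟩, φ, hφ, hi, hφX⟩ := hX
  exact ⟨_, hφX z hz⟩

/-- Immersed discs in `X` can be shrunk to neighbourhoods of a suitable point. -/
theorem ContainsDisc.exists_inter {d : ℕ} {X : Set V} (hX : ContainsDisc d X) :
    ∃ x ∈ X, ∀ W, IsOpen W → x ∈ W → ContainsDisc d (X ∩ W) := by
  obtain ⟨D, hD, ⟨z, hz⟩, φ, hφ, hi, hφX⟩ := hX
  exact ⟨φ z, hφX z hz, fun W hW hzW => ⟨D ∩ φ ⁻¹' W, hφ.continuousOn.isOpen_inter_preimage hD hW,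
    ⟨z, hz, hzW⟩, φ, hφ.mono inter_subset_left, fun w hw => hi w hw.1,
    fun w hw => ⟨hφX w hw.1, hw.2⟩⟩⟩

theorem ContainsDisc.image {V' : Type*} [NormedAddCommGroup V'] [NormedSpace ℂ V'] {d : ℕ}
    {X : Set V} (hX : ContainsDisc d X) (L : V ≃L[ℂ] V') : ContainsDisc d (L '' X) := by
  obtain ⟨D, hD, hne, φ, hφ, hi, hφX⟩ := hX
  refine ⟨D, hD, hne, L ∘ φ, L.differentiable.comp_differentiableOn hφ, fun z hz => ?_,
    fun z hz => mem_image_of_mem _ (hφX z hz)⟩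
  rw [L.comp_fderiv]
  exact L.injective.comp (hi z hz)

theorem ContainsDisc.le_finrank [FiniteDimensional ℂ V] {d : ℕ} {X : Set V}
    (hX : ContainsDisc d X) : d ≤ Module.finrank ℂ V := by
  obtain ⟨D, hD, ⟨z, hz⟩, φ, hφ, hi, hφX⟩ := hX
  simpa using LinearMap.finrank_le_finrank_of_injective (f := (fderiv ℂ φ z).toLinearMap) (hi z hz)

/-- Iterated derivatives of `h` in the direction of the second factor. -/
noncomputable def iteratedSndDeriv (h : V × ℂ → ℂ) : ℕ → V × ℂ → ℂ
  | 0 => h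
  | j + 1 => fun p => fderiv ℂ (iteratedSndDeriv h j) p (0, 1)

variable {h : V × ℂ → ℂ} {O : Set (V × ℂ)}

theorem differentiableOn_iteratedSndDeriv [FiniteDimensional ℂ V] (hO : IsOpen O)
    (hh : DifferentiableOn ℂ h O) (j : ℕ) : DifferentiableOn ℂ (iteratedSndDeriv h j) O := by
  induction j with
  | zero => exact hh
  | succ j ih => exact differentiableOn_fderiv_apply hO ih _

theorem iteratedDeriv_eq_iteratedSndDeriv [FiniteDimensional ℂ V] (hO : IsOpen O)
    (hh : DifferentiableOn ℂ h O) (j : ℕ) {x : V} {w : ℂ} (hw : (x, w) ∈ O) :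
    iteratedDeriv j (fun w => h (x, w)) w = iteratedSndDeriv h j (x, w) := by
  induction j generalizing w with
  | zero => simp [iteratedSndDeriv]
  | succ j ih =>
    rw [iteratedDeriv_succ, EventuallyEq.deriv_eq
      (((isOpen_fibre hO x).eventually_mem hw).mono fun w' hw' => ih hw')]
    have h1 : HasDerivAt (fun w : ℂ => (x, w)) ((0 : V), (1 : ℂ)) w :=
      (hasDerivAt_const w x).prodMk (hasDerivAt_id w)
    have h2 := ((differentiableOn_iteratedSndDeriv hO hh j).differentiableAt
      (hO.mem_nhds hw)).hasFDerivAt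
    exact (h2.comp_hasDerivAt w h1).deriv

theorem exists_iteratedSndDeriv_ne_zero [FiniteDimensional ℂ V] (hO : IsOpen O)
    (hh : DifferentiableOn ℂ h O) {x : V} {w : ℂ} (hw : (x, w) ∈ O)
    (hne : ¬∀ᶠ w' in 𝓝 w, h (x, w') = 0) : ∃ j, iteratedSndDeriv h j (x, w) ≠ 0 := by
  by_contra! hz
  have han : AnalyticAt ℂ (fun w => h (x, w)) w :=
    DifferentiableOn.analyticAt (s := {w | (x, w) ∈ O}) (hh.comp (by fun_prop) fun _ hw => hw)
      ((isOpen_fibre hO x).mem_nhds hw)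
  refine hne (analyticOrderAt_eq_top.1 (ENat.eq_top_iff_forall_ge.2 fun m => ?_))
  rw [natCast_le_analyticOrderAt_iff_iteratedDeriv_eq_zero han]
  intro i _
  rw [iteratedDeriv_eq_iteratedSndDeriv hO hh i hw, hz]

theorem ContainsDisc.fst [FiniteDimensional ℂ V] {d : ℕ} {X : Set (V × ℂ)} (hX : ContainsDisc d X)
    (hO : IsOpen O) (hh : DifferentiableOn ℂ h O) (hXO : X ⊆ O) (hXh : ∀ p ∈ X, h p = 0)
    (hne : ∀ x w, (x, w) ∈ X → ¬∀ᶠ w' in 𝓝 w, h (x, w') = 0) :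
    ContainsDisc d (Prod.fst '' X) := by
  classical
  obtain ⟨D, hD, ⟨z₀, hz₀⟩, φ, hφ, hi, hφX⟩ := hX
  have hex : ∃ j, ∃ z ∈ D, iteratedSndDeriv h j (φ z) ≠ 0 := by
    obtain ⟨j, hj⟩ := exists_iteratedSndDeriv_ne_zero hO hh (hXO (hφX z₀ hz₀))
      (hne _ _ (hφX z₀ hz₀))
    exact ⟨j, z₀, hz₀, hj⟩
  obtain ⟨z₁, hz₁, hz₁j⟩ := Nat.find_spec hex
  obtain ⟨i, hij⟩ : ∃ i, Nat.find hex = i + 1 := by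
    refine Nat.exists_eq_succ_of_ne_zero fun h0 => ?_
    rw [h0] at hz₁j
    exact hz₁j (hXh _ (hφX z₁ hz₁))
  have hmin : ∀ z ∈ D, iteratedSndDeriv h i (φ z) = 0 := by
    have := Nat.find_min hex (show i < Nat.find hex by omega)
    push Not at this
    exact this
  rw [hij] at hz₁j
  have hHd := differentiableOn_iteratedSndDeriv hO hh
  have hcomp : ContinuousOn (fun z => iteratedSndDeriv h (i + 1) (φ z)) D :=
    (hHd (i + 1)).continuousOn.comp hφ.continuousOn fun z hz => hXO (hφX z hz)
  refine ⟨D ∩ (fun z => iteratedSndDeriv h (i + 1) (φ z)) ⁻¹' {0}ᶜ,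
    hcomp.isOpen_inter_preimage hD isOpen_compl_singleton, ⟨z₁, hz₁, hz₁j⟩, fun z => (φ z).1,
    fun z hz => ((hφ z hz.1).mono inter_subset_left).fst, fun z hz => ?_,
    fun z hz => mem_image_of_mem _ (hφX z hz.1)⟩
  have hφz : HasFDerivAt φ (fderiv ℂ φ z) z :=
    (hφ.differentiableAt (hD.mem_nhds hz.1)).hasFDerivAt
  have hHz := ((hHd i).differentiableAt (hO.mem_nhds (hXO (hφX z hz.1)))).hasFDerivAt
  have h0 : fderiv ℂ (iteratedSndDeriv h i) (φ z) ∘L fderiv ℂ φ z = 0 :=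
    (hHz.comp z hφz).unique ((hasFDerivAt_const (0 : ℂ) z).congr_of_eventuallyEq
      ((hD.eventually_mem hz.1).mono hmin))
  rw [hφz.fst.fderiv]
  refine (injective_iff_map_eq_zero _).2 fun v hv => ?_
  replace hv : (fderiv ℂ φ z v).1 = 0 := hv
  have hv2 : fderiv ℂ φ z v = (fderiv ℂ φ z v).2 • ((0 : V), (1 : ℂ)) := by
    ext <;> simp [hv]
  have h1 : fderiv ℂ (iteratedSndDeriv h i) (φ z) (fderiv ℂ φ z v) = 0 :=
    DFunLike.congr_fun h0 v
  rw [hv2, map_smul, smul_eq_mul] at h1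
  have h2 : (fderiv ℂ φ z v).2 = 0 := (mul_eq_zero.1 h1).resolve_right hz.2
  refine hi z hz.1 ?_
  rw [map_zero, hv2, h2, zero_smul]

theorem IsChart.containsDisc_fst [FiniteDimensional ℂ V] {U : Set V} {c : ℂ} {r : ℝ}
    (H : IsChart h O U c r) {d : ℕ} {X : Set (V × ℂ)} (hX : ContainsDisc d X)
    (hXU : X ⊆ U ×ˢ ball c r) (hXh : ∀ p ∈ X, h p = 0) : ContainsDisc d (Prod.fst '' X) := by
  refine hX.fst H.isOpen_source H.differentiableOn
    (hXU.trans ((prod_mono_right ball_subset_closedBall).trans H.subset)) hXh fun x w hxw hev => ?_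
  obtain ⟨hx, hw⟩ := hXU hxw
  obtain ⟨s, hs⟩ := H.exists_isZeroMultiset hx
  refine infinite_of_mem_nhds w (inter_mem hev (isOpen_ball.mem_nhds hw))
    (s.toFinset.finite_toSet.subset fun y hy => ?_)
  simpa using (hs.mem_iff (ball_subset_closedBall hy.2)).2 hy.1

end Discs

section RegularPoints

open Metric Set

variable {V : Type} [NormedAddCommGroup V] [NormedSpace ℂ V]

theorem IsRegPtOfDim.of_inter {d : ℕ} {X W : Set V} {x : V} (h : IsRegPtOfDim d (X ∩ W) x)
    (hW : IsOpen W) (hx : x ∈ W) : IsRegPtOfDim d X x := by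
  obtain ⟨U, hU, hxU, e, L, Ω, g, hΩ, hg, hL⟩ := h
  exact ⟨W ∩ U, hW.inter hU, ⟨hx, hxU⟩, e, L, Ω, g, hΩ, hg, by rwa [← inter_assoc]⟩

theorem IsRegPtOfDim.image {V' : Type} [NormedAddCommGroup V'] [NormedSpace ℂ V'] {d : ℕ}
    {X : Set V} {x : V} (h : IsRegPtOfDim d X x) (A : V ≃L[ℂ] V') :
    IsRegPtOfDim d (A '' X) (A x) := by
  obtain ⟨U, hU, hxU, e, L, Ω, g, hΩ, hg, hL⟩ := h
  refine ⟨A '' U, A.toHomeomorph.isOpenMap U hU, mem_image_of_mem _ hxU, e, A.symm.trans L, Ω, g,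
    hΩ, hg, ?_⟩
  rw [← hL, ← image_inter A.injective, image_image]
  simp

theorem IsRegPtOfDim.containsDisc {d : ℕ} {X : Set V} {x : V} (h : IsRegPtOfDim d X x)
    (hx : x ∈ X) : ContainsDisc d X := by
  obtain ⟨U, hU, hxU, e, L, Ω, g, hΩ, hg, hL⟩ := h
  have hxL : L x ∈ L '' (X ∩ U) := mem_image_of_mem _ ⟨hx, hxU⟩
  rw [hL] at hxL
  have hd : ∀ z ∈ Ω, HasFDerivAt (fun z => L.symm (z, g z)) ((L.symm : _ →L[ℂ] V) ∘L
      (ContinuousLinearMap.id ℂ (Fin d → ℂ)).prod (fderiv ℂ g z)) z := fun z hz =>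
    L.symm.hasFDerivAt.comp z ((hasFDerivAt_id z).prodMk
      (hg.differentiableAt (hΩ.mem_nhds hz)).hasFDerivAt)
  refine ⟨Ω, hΩ, ⟨_, hxL.1⟩, fun z => L.symm (z, g z),
    fun z hz => (hd z hz).differentiableAt.differentiableWithinAt, fun z hz => ?_, fun z hz => ?_⟩
  · rw [(hd z hz).fderiv]
    exact L.symm.injective.comp fun v w hvw => congrArg Prod.fst hvw
  · have : (z, g z) ∈ L '' (X ∩ U) := by
      rw [hL]
      exact ⟨hz, rfl⟩
    obtain ⟨v, hv, hLv⟩ := this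
    change L.symm (z, g z) ∈ X
    rw [← hLv, L.symm_apply_apply]
    exact hv.1

theorem isRegPtOfDim_of_mem_nhds {N : ℕ} {X : Set (Fin N → ℂ)} {x : Fin N → ℂ} (hX : X ∈ 𝓝 x) :
    IsRegPtOfDim N X x := by
  refine ⟨interior X, isOpen_interior, mem_interior_iff_mem_nhds.2 hX, 0,
    (ContinuousLinearEquiv.prodUnique ℂ (Fin N → ℂ) (Fin 0 → ℂ)).symm, interior X, 0,
    isOpen_interior, differentiableOn_const _, ?_⟩
  ext ⟨z, t⟩
  constructor
  · rintro ⟨v, hv, hvz⟩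
    obtain rfl : v = z := congrArg Prod.fst hvz
    exact ⟨hv.2, Subsingleton.elim _ _⟩
  · rintro ⟨hz, -⟩
    exact ⟨z, ⟨interior_subset hz, hz⟩, Prod.ext rfl (Subsingleton.elim _ _)⟩

theorem exists_line_not_eventually_eq_zero {g : V → ℂ} {W : Set V} {p : V} (hW : IsOpen W)
    (hp : p ∈ W) (hg : DifferentiableOn ℂ g W) (hgp : g p = 0) (hne : ¬∀ᶠ x in 𝓝 p, g x = 0) :
    ∃ v ≠ 0, ¬∀ᶠ t : ℂ in 𝓝 0, g (p + t • v) = 0 := by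
  obtain ⟨ρ, hρ, hρW⟩ := Metric.isOpen_iff.1 hW p hp
  obtain ⟨q, hgq, hq⟩ := ((not_eventually.1 hne).and_eventually (ball_mem_nhds p hρ)).exists
  refine ⟨q - p, sub_ne_zero.2 fun h => hgq (h ▸ hgp), fun hev => hgq ?_⟩
  set A : ℂ → V := fun t => p + t • (q - p) with hA
  have hAd : Differentiable ℂ A := by fun_prop
  have hconv : Convex ℝ (A ⁻¹' ball p ρ) := by
    intro s hs t ht a b ha hb hab
    have := convex_ball p ρ hs ht ha hb hab
    rw [mem_preimage]
    convert this using 1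
    simp only [hA, smul_add, add_smul, smul_assoc]
    nth_rewrite 1 [← one_smul ℝ p]
    rw [← hab, add_smul]
    abel
  have hopen : IsOpen (A ⁻¹' ball p ρ) := isOpen_ball.preimage hAd.continuous
  have han : AnalyticOnNhd ℂ (g ∘ A) (A ⁻¹' ball p ρ) :=
    ((hg.mono hρW).comp hAd.differentiableOn fun t ht => ht).analyticOnNhd hopen
  have := han.eqOn_zero_of_preconnected_of_eventuallyEq_zero hconv.isPreconnected
    (z₀ := 0) (by simpa [hA] using hρ) hev (show (1 : ℂ) ∈ A ⁻¹' ball p ρ by simpa [hA] using hq)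
  simpa [hA] using this

theorem exists_continuousLinearEquiv_prod {m : ℕ} {v : Fin (m + 1) → ℂ} (hv : v ≠ 0) :
    ∃ L : (Fin (m + 1) → ℂ) ≃L[ℂ] (Fin m → ℂ) × ℂ, L v = (0, 1) := by
  obtain ⟨A, hA⟩ := SeparatingDual.exists_continuousLinearEquiv_apply_eq (R := ℂ) hv
    (y := (splitLast m).symm (0, 1)) (by simp)
  exact ⟨A.trans (splitLast m), by simp [hA]⟩

theorem IsAnalyticIn.exists_isRegPtOfDim {N d : ℕ} {O X : Set (Fin N → ℂ)}
    (hX : IsAnalyticIn O X) (hd : ContainsDisc d X) :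
    ∃ e ≥ d, ∃ x ∈ X, IsRegPtOfDim e X x := by
  induction N with
  | zero =>
    obtain ⟨x, hx⟩ := hd.nonempty
    refine ⟨0, by simpa using hd.le_finrank, x, hx, isRegPtOfDim_of_mem_nhds ?_⟩
    rw [Subsingleton.eq_univ_of_nonempty (s := X) ⟨x, hx⟩]
    exact univ_mem
  | succ m ih =>
    obtain ⟨p, hpX, hploc⟩ := hd.exists_inter
    obtain ⟨W, hW, hpW, q, g, hg, hXW⟩ := hX.2 p (hX.1 hpX)
    by_cases hall : ∀ i, ∀ᶠ x in 𝓝 p, g i x = 0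
    · refine ⟨m + 1, by simpa using hd.le_finrank, p, hpX, isRegPtOfDim_of_mem_nhds ?_⟩
      filter_upwards [eventually_all.2 hall, hW.mem_nhds hpW] with x hx hxW
      exact (hXW.symm.subset ⟨hxW, hx⟩).1
    obtain ⟨i₀, hi₀⟩ := not_forall.1 hall
    obtain ⟨v, hv, hline⟩ := exists_line_not_eventually_eq_zero hW hpW (hg i₀)
      ((hXW.subset ⟨hpX, hpW⟩).2 i₀) hi₀
    obtain ⟨L, hL⟩ := exists_continuousLinearEquiv_prod hv
    set G : Fin q → (Fin m → ℂ) × ℂ → ℂ := fun i => g i ∘ L.symm with hG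
    set O' := L.symm ⁻¹' W with hO'
    have hO'o : IsOpen O' := hW.preimage L.symm.continuous
    have hGd : ∀ i, DifferentiableOn ℂ (G i) O' := fun i =>
      (hg i).comp L.symm.differentiable.differentiableOn fun x hx => hx
    obtain ⟨r, -, δ, hδ, H⟩ := exists_isChart (a := (L p).1) (b := (L p).2) hO'o (hGd i₀)
      (by simpa [hO'] using hpW) (fun hev => hline (by
        have ht : Tendsto (fun t : ℂ => (L p).2 + t) (𝓝 0) (𝓝 (L p).2) :=
          Continuous.tendsto' (by fun_prop) _ _ (by simp)
        filter_upwards [ht.eventually hev] with t ht'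
        have : L.symm ((L p).1, (L p).2 + t) = p + t • v := by
          rw [L.symm_apply_eq, map_add, map_smul, hL]
          ext <;> simp
        rwa [← this])) one_pos
    obtain ⟨M, F, hF, hFX⟩ := H.exists_holomorphic_projection (isConnected_ball hδ).isPreconnected hGd
    set U := ball (L p).1 δ
    set X' := O' ∩ {p | ∀ i, G i p = 0} with hX'
    have hX'L : L '' (X ∩ W) = X' := by
      rw [hXW, L.image_eq_preimage_symm]
      rfl
    set Y := {x ∈ U | ∃ w ∈ ball (L p).2 r, ∀ i, G i (x, w) = 0} with hY
    have hYa : IsAnalyticIn U Y :=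
      ⟨fun x hx => hx.1, fun z hz => ⟨U, isOpen_ball, hz, M, F, hF, by
        rw [inter_eq_left.2 fun x hx => hx.1, hFX]⟩⟩
    have hdY : ContainsDisc d Y := by
      have hB : IsOpen (L ⁻¹' (U ×ˢ ball (L p).2 r)) :=
        (isOpen_ball.prod isOpen_ball).preimage L.continuous
      have h1 := (hploc (W ∩ L ⁻¹' (U ×ˢ ball (L p).2 r)) (hW.inter hB)
        ⟨hpW, mem_ball_self hδ, mem_ball_self H.radius_pos⟩).image L
      rw [← inter_assoc, image_inter_preimage, hX'L] at h1
      refine (H.containsDisc_fst h1 inter_subset_right fun x hx => hx.1.2 i₀).mono ?_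
      rintro _ ⟨x, hx, rfl⟩
      exact ⟨hx.2.1, x.2, hx.2.2, hx.1.2⟩
    obtain ⟨e, hde, y, hyY, hreg⟩ := ih hYa hdY
    obtain ⟨x, hx, hxreg⟩ := IsRegPtOfDim.exists_lift (ι := Unit) (X := X') (Y := Y)
      (fun _ => H) (fun _ x hxO hx => ⟨hxO, fun i => by
        have hc : ContinuousAt (G i) x := (hGd i).continuousOn.continuousAt (hO'o.mem_nhds hxO)
        simpa using closure_mono (t := {0}) (by rintro _ ⟨z, hz, rfl⟩; exact hz.2 i)
          (hc.continuousWithinAt.mem_closure_image hx)⟩)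
      (fun _ x _ hx => hx.2 i₀) isOpen_ball (fun x hx => ⟨fun h => ⟨(), h.2.choose,
        h.2.choose_spec.1, H.subset ⟨hx, ball_subset_closedBall h.2.choose_spec.1⟩,
        h.2.choose_spec.2⟩, fun ⟨_, w, hw, h⟩ => ⟨hx, w, hw, h.2⟩⟩) hyY hyY.1 hreg
    refine ⟨e, hde, L.symm x, ?_⟩
    have h2 := hxreg.image L.symm
    rw [← hX'L, L.symm_image_image] at h2
    exact ⟨(hXW.symm.subset hx).1, h2.of_inter hW hx.1⟩

end RegularPoints

section NashZeroSets

variable {n : ℕ} {U : Set (Fin n → ℂ)}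

theorem NashFn.mul {f g : (Fin n → ℂ) → ℂ} (hf : NashFn n U f) (hg : NashFn n U g) :
    NashFn n U fun x => f x * g x := by
  refine ⟨hf.1.mul hg.1, fun x₀ hx₀ => ?_⟩
  obtain ⟨V, hV, hxV, hfV⟩ := hf.2 x₀ hx₀
  obtain ⟨W, hW, hxW, hgW⟩ := hg.2 x₀ hx₀
  exact ⟨V ∩ W, hV.inter hW, ⟨hxV, hxW⟩,
    (AlgOn.mono hfV fun x hx => ⟨hx.1.1, hx.2⟩).mul (AlgOn.mono hgW fun x hx => ⟨hx.1.2, hx.2⟩)⟩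

theorem nashFn_const (hU : IsOpen U) (c : ℂ) : NashFn n U fun _ => c :=
  ⟨differentiableOn_const c, fun _ hx => ⟨U, hU, hx, algOn_const _ c⟩⟩

/-- `S` is the set of common zeros in `U` of finitely many Nash functions on `U`. -/
def IsNashZeroSet (U S : Set (Fin n → ℂ)) : Prop :=
  ∃ (M : ℕ) (N : Fin M → (Fin n → ℂ) → ℂ), (∀ s, NashFn n U (N s)) ∧ S = {x ∈ U | ∀ s, N s x = 0}

theorem IsNashZeroSet.empty (hU : IsOpen U) : IsNashZeroSet U ∅ :=
  ⟨1, fun _ _ => 1, fun _ => nashFn_const hU 1, by ext; simp⟩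

theorem IsNashZeroSet.union {S T : Set (Fin n → ℂ)} (hS : IsNashZeroSet U S)
    (hT : IsNashZeroSet U T) : IsNashZeroSet U (S ∪ T) := by
  obtain ⟨p, f, hf, rfl⟩ := hS
  obtain ⟨q, g, hg, rfl⟩ := hT
  refine ⟨p * q, fun s x => f (finProdFinEquiv.symm s).1 x * g (finProdFinEquiv.symm s).2 x,
    fun s => (hf _).mul (hg _), ?_⟩
  ext x
  rw [Set.mem_union, Set.mem_ofPred_eq, Set.mem_ofPred_eq, Set.mem_ofPred_eq, ← and_or_left]
  refine and_congr_right fun _ => ⟨?_, fun h => ?_⟩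
  · rintro (h | h) s
    · exact mul_eq_zero_of_left (h _) _
    · exact mul_eq_zero_of_right _ (h _)
  · by_contra! hne
    obtain ⟨⟨i, hi⟩, j, hj⟩ := hne
    simpa [hi, hj] using h (finProdFinEquiv (i, j))

theorem IsNashZeroSet.biUnion {ι : Type*} {t : Finset ι} {S : ι → Set (Fin n → ℂ)}
    (hU : IsOpen U) (hS : ∀ i ∈ t, IsNashZeroSet U (S i)) : IsNashZeroSet U (⋃ i ∈ t, S i) := by
  classical
  induction t using Finset.induction_on with
  | empty => simpa using IsNashZeroSet.empty hU
  | insert a s _ ih =>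
    rw [Finset.set_biUnion_insert]
    exact (hS a (Finset.mem_insert_self a s)).union
      (ih fun i hi => hS i (Finset.mem_insert_of_mem hi))

theorem IsNashIn.isAnalyticIn {Ω X : Set (Fin n → ℂ)} (hX : IsNashIn n Ω X) : IsAnalyticIn Ω X := by
  refine ⟨hX.1, fun z hz => ?_⟩
  obtain ⟨W, hW, hzW, q, g, hg, hXW⟩ := hX.2 z hz
  exact ⟨W, hW, hzW, q, g, fun i => (hg i).1, hXW⟩

end NashZeroSets

section FiniteProjection

open Metric Set

variable {n : ℕ}

/-- On the open set `O`, the set `X` is defined by the functions `g i`, each satisfying a primitive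
polynomial relation. -/
structure IsNashEquations {q : ℕ} (X O : Set ((Fin n → ℂ) × ℂ))
    (g : Fin q → (Fin n → ℂ) × ℂ → ℂ) : Prop where
  differentiableOn : ∀ i, DifferentiableOn ℂ (g i) O
  exists_polyRel : ∀ i, ∃ Q, Q.IsPrimitive ∧ PolyRel O (g i) Q
  mem_iff : ∀ p ∈ O, p ∈ X ↔ ∀ i, g i p = 0

theorem IsNashEquations.mem_of_mem_closure {q : ℕ} {X O : Set ((Fin n → ℂ) × ℂ)}
    {g : Fin q → (Fin n → ℂ) × ℂ → ℂ} (h : IsNashEquations X O g) (hO : IsOpen O)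
    {p : (Fin n → ℂ) × ℂ} (hp : p ∈ O) (hpX : p ∈ closure X) : p ∈ X := by
  refine (h.mem_iff p hp).2 fun i => ?_
  by_contra hne
  have hopen : IsOpen (O ∩ g i ⁻¹' {0}ᶜ) :=
    (h.differentiableOn i).continuousOn.isOpen_inter_preimage hO isOpen_compl_singleton
  obtain ⟨x, ⟨hxO, hx0⟩, hxX⟩ := mem_closure_iff.1 hpX _ hopen ⟨hp, hne⟩
  exact hx0 ((h.mem_iff x hxO).1 hxX i)

/-- `X` is defined near `U × closedBall c r` by functions satisfying primitive polynomial
relations, one of which gives a chart. -/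
def IsNashChart (X : Set ((Fin n → ℂ) × ℂ)) (U : Set (Fin n → ℂ)) (c : ℂ) (r : ℝ) : Prop :=
  ∃ (O : Set ((Fin n → ℂ) × ℂ)) (q : ℕ) (g : Fin q → (Fin n → ℂ) × ℂ → ℂ) (i₀ : Fin q),
    IsNashEquations X O g ∧ IsChart (g i₀) O U c r

theorem IsNashChart.isNashZeroSet {X : Set ((Fin n → ℂ) × ℂ)} {U : Set (Fin n → ℂ)} {c : ℂ}
    {r : ℝ} (H : IsNashChart X U c r) (hU : IsPreconnected U) :
    IsNashZeroSet U {x ∈ U | ∃ w ∈ ball c r, (x, w) ∈ X} := by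
  obtain ⟨O, q, g, i₀, hg, H⟩ := H
  obtain ⟨M, N, hN, hNX⟩ := H.exists_nash_projection hU hg.differentiableOn hg.exists_polyRel
  refine ⟨M, N, hN, ?_⟩
  rw [← hNX]
  ext x
  exact and_congr_right fun hx => exists_congr fun w => and_congr_right fun hw =>
    hg.mem_iff _ (H.subset ⟨hx, ball_subset_closedBall hw⟩)

theorem interior_eq_empty_of_isolated {F : Set ℂ} (hF : IsCompact F)
    (h : ∀ w ∈ F, F ∈ 𝓝 w ∨ ∀ᶠ w' in 𝓝[≠] w, w' ∉ F) : interior F = ∅ := by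
  have hcl : IsClosed (interior F) := by
    refine isClosed_of_closure_subset fun w hw => ?_
    refine mem_interior_iff_mem_nhds.2 ((h w ?_).resolve_right fun hev => ?_)
    · exact hF.isClosed.closure_subset_iff.2 interior_subset hw
    · rw [eventually_nhdsWithin_iff, ← eventually_eventually_nhds] at hev
      obtain ⟨w', hw', hev'⟩ := ((mem_closure_iff_frequently.1 hw).and_eventually hev).exists
      refine infinite_of_mem_nhds w' (mem_of_superset
        (inter_mem (mem_interior_iff_mem_nhds.1 hw') hev') ?_) (finite_singleton w)
      intro y hy
      by_contra hyw
      exact hy.2 hyw hy.1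
  refine (isClopen_iff.1 ⟨hcl, isOpen_interior⟩).resolve_right fun huniv => ?_
  exact noncompact_univ ℂ (by rwa [← univ_subset_iff.1 (huniv.symm.subset.trans interior_subset)])

variable {Ω : Set (Fin n → ℂ)} {X : Set ((Fin n → ℂ) × ℂ)}

theorem exists_not_eventually_eq_zero
    (hX : ∀ p ∈ X, ∃ O, IsOpen O ∧ p ∈ O ∧ ∃ (q : ℕ) (g : Fin q → (Fin n → ℂ) × ℂ → ℂ),
      IsNashEquations X O g) {a : Fin n → ℂ} (hF : IsCompact {w | (a, w) ∈ X}) {w : ℂ}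
    (hw : (a, w) ∈ X) : ∃ O, IsOpen O ∧ (a, w) ∈ O ∧ ∃ (q : ℕ) (g : Fin q → (Fin n → ℂ) × ℂ → ℂ),
      IsNashEquations X O g ∧ ∃ i, ¬∀ᶠ w' in 𝓝 w, g i (a, w') = 0 := by
  have key : ∀ w, (a, w) ∈ X → ∀ O, IsOpen O → (a, w) ∈ O → ∀ (q : ℕ)
      (g : Fin q → (Fin n → ℂ) × ℂ → ℂ), IsNashEquations X O g →
      (∀ i, ∀ᶠ w' in 𝓝 w, g i (a, w') = 0) → {w | (a, w) ∈ X} ∈ 𝓝 w := by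
    intro w _ O hO hwO q g hg hev
    filter_upwards [eventually_all.2 hev, (isOpen_fibre hO a).mem_nhds hwO] with w' hw' hw'O
    exact (hg.mem_iff _ hw'O).2 hw'
  have hint : interior {w | (a, w) ∈ X} = ∅ := by
    refine interior_eq_empty_of_isolated hF fun w hw => ?_
    obtain ⟨O, hO, hwO, q, g, hg⟩ := hX _ hw
    by_cases hall : ∀ i, ∀ᶠ w' in 𝓝 w, g i (a, w') = 0
    · exact Or.inl (key w hw O hO hwO q g hg hall)
    · obtain ⟨i, hi⟩ := not_forall.1 hall
      have han : AnalyticAt ℂ (fun w => g i (a, w)) w :=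
        DifferentiableOn.analyticAt (s := {w | (a, w) ∈ O})
          ((hg.differentiableOn i).comp (by fun_prop) fun _ hw => hw)
          ((isOpen_fibre hO a).mem_nhds hwO)
      right
      filter_upwards [han.eventually_eq_zero_or_eventually_ne_zero.resolve_left hi,
        nhdsWithin_le_nhds ((isOpen_fibre hO a).mem_nhds hwO)] with w' hw' hw'O hw'X
      exact hw' ((hg.mem_iff _ hw'O).1 hw'X i)
  obtain ⟨O, hO, hwO, q, g, hg⟩ := hX _ hw
  refine ⟨O, hO, hwO, q, g, hg, not_forall.1 fun hall => ?_⟩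
  have : w ∈ interior {w | (a, w) ∈ X} :=
    mem_interior_iff_mem_nhds.2 (key w hw O hO hwO q g hg hall)
  simp [hint] at this

theorem exists_finite_nashCharts (hΩ : IsOpen Ω)
    (hX : ∀ p ∈ X, ∃ O, IsOpen O ∧ p ∈ O ∧ ∃ (q : ℕ) (g : Fin q → (Fin n → ℂ) × ℂ → ℂ),
      IsNashEquations X O g)
    (hprop : ∀ K ⊆ Ω, IsCompact K → IsCompact {p ∈ X | p.1 ∈ K}) {a : Fin n → ℂ} (ha : a ∈ Ω) :
    ∃ ε > 0, ball a ε ⊆ Ω ∧ ∃ (t : Finset ℂ) (r : ℂ → ℝ),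
      (∀ w ∈ t, IsNashChart X (ball a ε) w (r w)) ∧
      ∀ p ∈ X, p.1 ∈ ball a ε → ∃ w ∈ t, p.2 ∈ ball w (r w) := by
  classical
  have hF : IsCompact {w | (a, w) ∈ X} := by
    convert (hprop {a} (singleton_subset_iff.2 ha) isCompact_singleton).image continuous_snd
    ext w
    constructor
    · exact fun hw => ⟨(a, w), ⟨hw, rfl⟩, rfl⟩
    · rintro ⟨⟨_, w⟩, ⟨hw, rfl⟩, rfl⟩
      exact hw
  have hchart : ∀ w, ∃ r > 0, ∃ δ > 0, (a, w) ∈ X → IsNashChart X (ball a δ) w r := by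
    intro w
    by_cases hw : (a, w) ∈ X
    · obtain ⟨O, hO, hwO, q, g, hg, i, hi⟩ := exists_not_eventually_eq_zero hX hF hw
      obtain ⟨r, -, δ, hδ, H⟩ := exists_isChart hO (hg.differentiableOn i) hwO hi one_pos
      exact ⟨r, H.radius_pos, δ, hδ, fun _ => ⟨O, q, g, i, hg, H⟩⟩
    · exact ⟨1, one_pos, 1, one_pos, fun h => absurd h hw⟩
  choose r hr δ hδ H using hchart
  obtain ⟨t, htF, ht⟩ := hF.elim_nhds_subcover (fun w => ball w (r w))
    fun w _ => ball_mem_nhds w (hr w)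
  obtain ⟨ρ, hρ, hρΩ⟩ := nhds_basis_closedBall.mem_iff.1 (hΩ.mem_nhds ha)
  have hC : IsCompact (Prod.fst '' ({p ∈ X | p.1 ∈ closedBall a ρ} \
      {p | p.2 ∈ ⋃ w ∈ t, ball w (r w)})) :=
    ((hprop _ hρΩ (isCompact_closedBall a ρ)).diff
      ((isOpen_biUnion fun _ _ => isOpen_ball).preimage continuous_snd)).image continuous_fst
  have haC : a ∉ Prod.fst '' ({p ∈ X | p.1 ∈ closedBall a ρ} \
      {p | p.2 ∈ ⋃ w ∈ t, ball w (r w)}) := by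
    rintro ⟨⟨_, w⟩, ⟨⟨hw, -⟩, hwt⟩, rfl⟩
    exact hwt (ht hw)
  have hnhds : ball a ρ ∩ (Prod.fst '' ({p ∈ X | p.1 ∈ closedBall a ρ} \
      {p | p.2 ∈ ⋃ w ∈ t, ball w (r w)}))ᶜ ∩ ⋂ w ∈ t, ball a (δ w) ∈ 𝓝 a :=
    inter_mem (inter_mem (ball_mem_nhds a hρ) (hC.isClosed.isOpen_compl.mem_nhds haC))
      ((biInter_finset_mem t).2 fun w _ => ball_mem_nhds a (hδ w))
  obtain ⟨ε, hε, hεs⟩ := Metric.mem_nhds_iff.1 hnhds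
  refine ⟨ε, hε, fun x hx => hρΩ (ball_subset_closedBall (hεs hx).1.1), t, r, fun w hw => ?_,
    fun p hp hpε => ?_⟩
  · obtain ⟨O, q, g, i, hg, H⟩ := H w (htF w hw)
    exact ⟨O, q, g, i, hg, H.mono isOpen_ball fun x hx => mem_iInter₂.1 (hεs hx).2 w hw⟩
  · by_contra hne
    exact (hεs hpε).1.2 ⟨p, ⟨⟨hp, ball_subset_closedBall (hεs hpε).1.1⟩, by simpa using hne⟩, rfl⟩

/-- The image of a Nash set under a proper projection along one coordinate. -/
theorem isNashIn_image_fst (hΩ : IsOpen Ω) (hXΩ : ∀ p ∈ X, p.1 ∈ Ω)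
    (hX : ∀ p ∈ X, ∃ O, IsOpen O ∧ p ∈ O ∧ ∃ (q : ℕ) (g : Fin q → (Fin n → ℂ) × ℂ → ℂ),
      IsNashEquations X O g)
    (hprop : ∀ K ⊆ Ω, IsCompact K → IsCompact {p ∈ X | p.1 ∈ K}) :
    IsNashIn n Ω (Prod.fst '' X) := by
  refine ⟨fun _ ⟨p, hp, hpx⟩ => hpx ▸ hXΩ p hp, fun a ha => ?_⟩
  obtain ⟨ε, hε, -, t, r, H, hcov⟩ := exists_finite_nashCharts hΩ hX hprop ha
  refine ⟨ball a ε, isOpen_ball, mem_ball_self hε, ?_⟩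
  convert IsNashZeroSet.biUnion (t := t) isOpen_ball fun w hw =>
    (H w hw).isNashZeroSet (isConnected_ball hε).isPreconnected
  unfold IsNashZeroSet
  convert Iff.rfl
  ext x
  simp only [mem_iUnion, mem_inter_iff, exists_prop]
  constructor
  · rintro ⟨w, hw, hx, w', hw', hxw⟩
    exact ⟨⟨_, hxw, rfl⟩, hx⟩
  · rintro ⟨⟨p, hp, rfl⟩, hx⟩
    obtain ⟨w, hw, hpw⟩ := hcov p hp hx
    exact ⟨w, hw, hx, p.2, hpw, hp⟩

theorem exists_isRegPtOfDim_of_image_fst (hΩ : IsOpen Ω) (hXΩ : ∀ p ∈ X, p.1 ∈ Ω)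
    (hX : ∀ p ∈ X, ∃ O, IsOpen O ∧ p ∈ O ∧ ∃ (q : ℕ) (g : Fin q → (Fin n → ℂ) × ℂ → ℂ),
      IsNashEquations X O g)
    (hprop : ∀ K ⊆ Ω, IsCompact K → IsCompact {p ∈ X | p.1 ∈ K}) {e : ℕ} {y : Fin n → ℂ}
    (hy : y ∈ Prod.fst '' X) (hreg : IsRegPtOfDim e (Prod.fst '' X) y) :
    ∃ x ∈ X, IsRegPtOfDim e X x := by
  have hyΩ : y ∈ Ω := (isNashIn_image_fst hΩ hXΩ hX hprop).1 hy
  obtain ⟨ε, hε, -, t, r, H, hcov⟩ := exists_finite_nashCharts hΩ hX hprop hyΩ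
  choose! O q g i hg H using H
  refine IsRegPtOfDim.exists_lift (ι := t) (fun w => H w w.2)
    (fun w p hp hpX => (hg w w.2).mem_of_mem_closure (H w w.2).isOpen_source hp hpX)
    (fun w p hp hpX => ((hg w w.2).mem_iff p hp).1 hpX _) isOpen_ball (fun x hx => ⟨?_, ?_⟩) hy
    (mem_ball_self hε) hreg
  · rintro ⟨p, hp, rfl⟩
    obtain ⟨w, hw, hpw⟩ := hcov p hp hx
    exact ⟨⟨w, hw⟩, p.2, hpw, hp⟩
  · rintro ⟨w, w', hw', hxw⟩
    exact ⟨_, hxw, rfl⟩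

theorem exists_isRegPtOfDim_image_fst (hΩ : IsOpen Ω) (hXΩ : ∀ p ∈ X, p.1 ∈ Ω)
    (hX : ∀ p ∈ X, ∃ O, IsOpen O ∧ p ∈ O ∧ ∃ (q : ℕ) (g : Fin q → (Fin n → ℂ) × ℂ → ℂ),
      IsNashEquations X O g)
    (hprop : ∀ K ⊆ Ω, IsCompact K → IsCompact {p ∈ X | p.1 ∈ K}) {d : ℕ} {x : (Fin n → ℂ) × ℂ}
    (hx : x ∈ X) (hreg : IsRegPtOfDim d X x) :
    ∃ e ≥ d, ∃ y ∈ Prod.fst '' X, IsRegPtOfDim e (Prod.fst '' X) y := by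
  refine (isNashIn_image_fst hΩ hXΩ hX hprop).isAnalyticIn.exists_isRegPtOfDim ?_
  obtain ⟨p, hp, hploc⟩ := (hreg.containsDisc hx).exists_inter
  obtain ⟨ε, hε, -, t, r, H, hcov⟩ := exists_finite_nashCharts hΩ hX hprop (hXΩ p hp)
  obtain ⟨w, hw, hpw⟩ := hcov p hp (mem_ball_self hε)
  obtain ⟨O, q, g, i, hg, H⟩ := H w hw
  refine (H.containsDisc_fst (hploc (ball p.1 ε ×ˢ ball w (r w)) (isOpen_ball.prod isOpen_ball)
    ⟨mem_ball_self hε, hpw⟩) inter_subset_right fun z hz => ?_).mono (image_mono inter_subset_left)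
  exact (hg.mem_iff z (H.subset ⟨hz.2.1, ball_subset_closedBall hz.2.2⟩)).1 hz.1 i

end FiniteProjection

section Main

open Metric Set

theorem IsNashIn.exists_isNashEquations {n : ℕ} {Ω X : Set (Fin (n + 1) → ℂ)}
    (hX : IsNashIn (n + 1) Ω X) {p : (Fin n → ℂ) × ℂ} (hp : p ∈ splitLast n '' X) :
    ∃ O, IsOpen O ∧ p ∈ O ∧ ∃ (q : ℕ) (g : Fin q → (Fin n → ℂ) × ℂ → ℂ),
      IsNashEquations (splitLast n '' X) O g := by
  obtain ⟨x, hx, rfl⟩ := hp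
  obtain ⟨W, hW, hxW, q, g, hg, hXW⟩ := hX.2 x (hX.1 hx)
  have hxW' : (splitLast n).symm (splitLast n x) ∈ W := by
    rwa [ContinuousLinearEquiv.symm_apply_apply]
  choose V hV hxV Q hQ hQV using fun i => (hg i).exists_polyRel hW hxW'
  refine ⟨(splitLast n).symm ⁻¹' W ∩ ⋂ i, V i,
    (hW.preimage (splitLast n).symm.continuous).inter (isOpen_iInter_of_finite hV),
    ⟨hxW', mem_iInter.2 hxV⟩, q, fun i => g i ∘ (splitLast n).symm, fun i => ?_, fun i => ?_,
    fun p hp => ?_⟩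
  · exact (hg i).1.comp (splitLast n).symm.differentiable.differentiableOn fun p hp => hp.1
  · exact ⟨Q i, hQ i, fun p hp => hQV i p (mem_iInter.1 hp.2 i)⟩
  · rw [ContinuousLinearEquiv.image_eq_preimage_symm, mem_preimage]
    have := Set.ext_iff.1 hXW ((splitLast n).symm p)
    exact ⟨fun h => (this.1 ⟨h, hp.1⟩).2, fun h => (this.2 ⟨hp.1, h⟩).1⟩

theorem IsNashIn.image_castSucc {n : ℕ} {Ω : Set (Fin n → ℂ)} (hΩ : IsOpen Ω)
    {X : Set (Fin (n + 1) → ℂ)} (hX : IsNashIn (n + 1) {x | (fun i : Fin n => x i.castSucc) ∈ Ω} X)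
    (hprop : ∀ K ⊆ Ω, IsCompact K → IsCompact {x ∈ X | (fun i : Fin n => x i.castSucc) ∈ K}) :
    IsNashIn n Ω ((fun x (i : Fin n) => x i.castSucc) '' X) ∧
    (∀ e, ∀ y ∈ (fun x (i : Fin n) => x i.castSucc) '' X,
      IsRegPtOfDim e ((fun x (i : Fin n) => x i.castSucc) '' X) y →
        ∃ x ∈ X, IsRegPtOfDim e X x) ∧
    ∀ d, ∀ x ∈ X, IsRegPtOfDim d X x → ∃ e ≥ d, ∃ y ∈ (fun x (i : Fin n) => x i.castSucc) '' X,
      IsRegPtOfDim e ((fun x (i : Fin n) => x i.castSucc) '' X) y := by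
  have hfst : (fun x (i : Fin n) => x i.castSucc) '' X = Prod.fst '' (splitLast n '' X) := by
    rw [image_image]
    rfl
  have hXΩ : ∀ p ∈ splitLast n '' X, p.1 ∈ Ω := by
    rintro _ ⟨x, hx, rfl⟩
    exact hX.1 hx
  have hprop' : ∀ K ⊆ Ω, IsCompact K → IsCompact {p ∈ splitLast n '' X | p.1 ∈ K} := by
    intro K hKΩ hK
    convert (hprop K hKΩ hK).image (splitLast n).continuous
    ext p
    constructor
    · rintro ⟨⟨x, hx, rfl⟩, hp⟩
      exact ⟨x, ⟨hx, hp⟩, rfl⟩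
    · rintro ⟨x, ⟨hx, hp⟩, rfl⟩
      exact ⟨⟨x, hx, rfl⟩, hp⟩
  have hloc := fun p => hX.exists_isNashEquations (p := p)
  rw [hfst]
  refine ⟨isNashIn_image_fst hΩ hXΩ hloc hprop', fun e y hy hreg => ?_, fun d x hx hreg => ?_⟩
  · obtain ⟨_, ⟨x, hx, rfl⟩, hxreg⟩ := exists_isRegPtOfDim_of_image_fst hΩ hXΩ hloc hprop' hy hreg
    refine ⟨x, hx, ?_⟩
    have := hxreg.image (splitLast n).symm
    rwa [ContinuousLinearEquiv.symm_image_image, ContinuousLinearEquiv.symm_apply_apply] at this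
  · exact exists_isRegPtOfDim_image_fst hΩ hXΩ hloc hprop' (mem_image_of_mem _ hx)
      (hreg.image (splitLast n))

theorem IsNashIn.image_castAdd {n : ℕ} (k : ℕ) {Ω : Set (Fin n → ℂ)} (hΩ : IsOpen Ω)
    {X : Set (Fin (n + k) → ℂ)}
    (hX : IsNashIn (n + k) {x | (fun i : Fin n => x (Fin.castAdd k i)) ∈ Ω} X)
    (hprop : ∀ K ⊆ Ω, IsCompact K →
      IsCompact {x ∈ X | (fun i : Fin n => x (Fin.castAdd k i)) ∈ K}) :
    IsNashIn n Ω ((fun x (i : Fin n) => x (Fin.castAdd k i)) '' X) ∧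
    (∀ e, ∀ y ∈ (fun x (i : Fin n) => x (Fin.castAdd k i)) '' X,
      IsRegPtOfDim e ((fun x (i : Fin n) => x (Fin.castAdd k i)) '' X) y →
        ∃ x ∈ X, IsRegPtOfDim e X x) ∧
    ∀ d, ∀ x ∈ X, IsRegPtOfDim d X x →
      ∃ e ≥ d, ∃ y ∈ (fun x (i : Fin n) => x (Fin.castAdd k i)) '' X,
        IsRegPtOfDim e ((fun x (i : Fin n) => x (Fin.castAdd k i)) '' X) y := by
  induction k with
  | zero =>
    have hid : (fun x (i : Fin n) => x (Fin.castAdd 0 i)) '' X = X := image_id X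
    rw [hid]
    exact ⟨hX, fun e y hy h => ⟨y, hy, h⟩, fun d x hx h => ⟨d, le_rfl, x, hx, h⟩⟩
  | succ k ih =>
    have hc : Continuous fun (x : Fin (n + k) → ℂ) (i : Fin n) => x (Fin.castAdd k i) := by fun_prop
    have hc' : Continuous fun (x : Fin (n + k + 1) → ℂ) (i : Fin (n + k)) => x i.castSucc := by
      fun_prop
    obtain ⟨hX', hl, hp⟩ := IsNashIn.image_castSucc (n := n + k) (hΩ.preimage hc) hX
      (fun K hKΩ hK => by
        have hKeq : {x ∈ X | (fun i : Fin (n + k) => x i.castSucc) ∈ K} =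
            {x ∈ X | (fun i : Fin n => x (Fin.castAdd (k + 1) i)) ∈
              (fun (x : Fin (n + k) → ℂ) (i : Fin n) => x (Fin.castAdd k i)) '' K} ∩
              (fun (x : Fin (n + k + 1) → ℂ) (i : Fin (n + k)) => x i.castSucc) ⁻¹' K := by
          ext x
          exact ⟨fun h => ⟨⟨h.1, _, h.2, rfl⟩, h.2⟩, fun h => ⟨h.1.1, h.2⟩⟩
        exact (congrArg IsCompact hKeq).mpr ((hprop _ (image_subset_iff.2 hKΩ) (hK.image hc)).inter_right
          (hK.isClosed.preimage hc')))
    obtain ⟨hY, hl', hp'⟩ := ih hX' fun K hKΩ hK => by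
      convert (hprop K hKΩ hK).image hc'
      ext y
      constructor
      · rintro ⟨⟨x, hx, rfl⟩, hy⟩
        exact ⟨x, ⟨hx, hy⟩, rfl⟩
      · rintro ⟨x, ⟨hx, hy⟩, rfl⟩
        exact ⟨⟨x, hx, rfl⟩, hy⟩
    rw [image_image] at hY hl' hp'
    refine ⟨hY, fun e y hy h => ?_, fun d x hx h => ?_⟩
    · obtain ⟨x, hx, hxr⟩ := hl' e y hy h
      exact hl e x hx hxr
    · obtain ⟨e, hde, y, hy, hyr⟩ := hp d x hx h
      obtain ⟨e', hee', z, hz, hzr⟩ := hp' e y hy hyr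
      exact ⟨e', hde.trans hee', z, hz, hzr⟩

end Main

theorem stmt_5 (n k : ℕ) (Ω : Set (Fin n → ℂ)) (hΩ : IsOpen Ω)
    (X : Set (Fin (n + k) → ℂ))
    (hX : IsNashIn (n + k) {x | (fun i : Fin n => x (Fin.castAdd k i)) ∈ Ω} X)
    (hprop : ∀ K ⊆ Ω, IsCompact K →
      IsCompact {x ∈ X | (fun i : Fin n => x (Fin.castAdd k i)) ∈ K}) :
    IsNashIn n Ω ((fun x : Fin (n + k) → ℂ => fun i : Fin n => x (Fin.castAdd k i)) '' X) ∧
    ∀ d : ℕ, SetDimIs X d ↔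
      SetDimIs ((fun x : Fin (n + k) → ℂ => fun i : Fin n => x (Fin.castAdd k i)) '' X) d := by
  obtain ⟨hY, hlift, hproj⟩ := IsNashIn.image_castAdd k hΩ hX hprop
  refine ⟨hY, fun d => ⟨fun ⟨⟨x, hx, hxr⟩, hmax⟩ => ?_, fun ⟨⟨y, hy, hyr⟩, hmax⟩ => ?_⟩⟩
  · have hle : ∀ e, ∀ y ∈ (fun (x : Fin (n + k) → ℂ) (i : Fin n) => x (Fin.castAdd k i)) '' X,
        IsRegPtOfDim e ((fun (x : Fin (n + k) → ℂ) (i : Fin n) => x (Fin.castAdd k i)) '' X) y →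
          e ≤ d := fun e y hy hyr => by
      obtain ⟨x, hx, hxr⟩ := hlift e y hy hyr
      exact hmax e x hx hxr
    obtain ⟨e, hde, y, hy, hyr⟩ := hproj d x hx hxr
    obtain rfl : e = d := le_antisymm (hle e y hy hyr) hde
    exact ⟨⟨y, hy, hyr⟩, hle⟩
  · refine ⟨hlift d y hy hyr, fun e x hx hxr => ?_⟩
    obtain ⟨e', hee', z, hz, hzr⟩ := hproj e x hx hxr
    exact hee'.trans (hmax e' z hz hzr)
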